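/- arXiv:1611.09156 — 4 statements merged into one kernel-verified Lean document; each statement's English description precedes it below -/
import Mathlib

section
/- (Duality between self-interlacing and Hurwitz stable polynomials.) Let p(z) = a_0 z^n + a_1 z^{n−1} + ⋯ + a_n be a real polynomial of degree n ≥ 1 with a_0 > 0, and let q(z) = Σ_{k=0}^n (−1)^{k(k+1)/2} a_k z^{n−k} be its dual polynomial. Then p is self-interlacing of kind I if and only if q is Hurwitz stable. -/
open Polynomial

/-- A real polynomial `p` is *self-interlacing of kind I* if all of its `natDegree` roots
are real and simple and, listed in order of decreasing absolute value `λ₀, λ₁, …`,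
they satisfy `λ₀ > -λ₁ > λ₂ > -λ₃ > ⋯ > 0`. -/
def SelfInterlacingI (p : Polynomial ℝ) : Prop :=
  ∃ lam : Fin p.natDegree → ℝ,
    (p = Polynomial.C p.leadingCoeff *
        ∏ i : Fin p.natDegree, (Polynomial.X - Polynomial.C (lam i))) ∧
    StrictAnti (fun i : Fin p.natDegree => (-1 : ℝ) ^ (i : ℕ) * lam i) ∧
    ∀ i : Fin p.natDegree, 0 < (-1 : ℝ) ^ (i : ℕ) * lam i
/-- The dual polynomial `q(z) = Σ_{k=0}^n (-1)^{k(k+1)/2} a_k z^{n-k}`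
of `p(z) = Σ_{k=0}^n a_k z^{n-k}`, where `n = p.natDegree`. -/
noncomputable def dualPoly (p : Polynomial ℝ) : Polynomial ℝ :=
  ∑ k ∈ Finset.range (p.natDegree + 1),
    Polynomial.C ((-1 : ℝ) ^ (k * (k + 1) / 2) * p.coeff (p.natDegree - k)) *
      Polynomial.X ^ (p.natDegree - k)
/-- A real polynomial is *Hurwitz stable* if all of its complex roots have
negative real part. -/
def HurwitzStable (p : Polynomial ℝ) : Prop :=
  ∀ z : ℂ, Polynomial.aeval z p = 0 → z.re < 0

/-- The reflection `(-1)^n p(-z)` of a real polynomial `p` of degree `n`; it has the same degree and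
leading coefficient as `p`. -/
noncomputable def reflection (p : ℝ[X]) : ℝ[X] :=
  C ((-1) ^ p.natDegree) * p.comp (-X)

/-- The complex polynomial `p - i r`. -/
noncomputable def subIMul (p r : ℝ[X]) : ℂ[X] :=
  p.map (algebraMap ℝ ℂ) - C Complex.I * r.map (algebraMap ℝ ℂ)

theorem exists_fin_prod_of_splits {K : Type*} [Field K] {f : K[X]} (hf : f.Splits) :
    ∃ r : Fin f.natDegree → K, f = C f.leadingCoeff * ∏ i, (X - C (r i)) := by
  have hlen : f.roots.toList.length = f.natDegree := by
    rw [Multiset.length_toList, hf.natDegree_eq_card_roots]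
  refine ⟨fun i => f.roots.toList.get (i.cast hlen.symm), ?_⟩
  have h : ∏ i : Fin f.natDegree, (X - C (f.roots.toList.get (i.cast hlen.symm))) =
      ∏ i : Fin f.roots.toList.length, (X - C (f.roots.toList.get i)) :=
    Fintype.prod_equiv (finCongr hlen.symm) _ _ fun _ => rfl
  rw [h]
  conv_lhs => rw [hf.eq_prod_roots]
  congr 1
  rw [← List.prod_ofFn, ← Multiset.prod_coe]
  congr 1
  conv_lhs => rw [← Multiset.coe_toList f.roots]
  rw [Multiset.map_coe]
  exact congrArg _ ((congrArg _ (List.ofFn_get _).symm).trans List.map_ofFn)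

theorem eval_subIMul (p r : ℝ[X]) (z : ℂ) :
    (subIMul p r).eval z = aeval z p - Complex.I * aeval z r := by
  simp [subIMul, aeval_def, eval_map]

theorem norm_eval_conj_lt {f : ℂ[X]} (hdeg : f.natDegree ≠ 0)
    (hf : ∀ z, f.eval z = 0 → 0 < z.im) {z : ℂ} (hz : z.im < 0) :
    ‖f.eval (starRingEnd ℂ z)‖ < ‖f.eval z‖ := by
  obtain ⟨r, hr⟩ := exists_fin_prod_of_splits (IsAlgClosed.splits f)
  have hr0 : ∀ i, 0 < (r i).im := fun i => hf _ (by
    rw [hr, eval_mul, eval_prod, Finset.prod_eq_zero (Finset.mem_univ i) (by simp), mul_zero])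
  have hne : f.leadingCoeff ≠ 0 := by
    rw [Ne, leadingCoeff_eq_zero]; rintro rfl; simp at hdeg
  have hev : ∀ w, ‖f.eval w‖ = ‖f.leadingCoeff‖ * ∏ i, ‖w - r i‖ := fun w => by
    conv_lhs => rw [hr]
    simp [eval_prod]
  have hlt : ∀ i, ‖starRingEnd ℂ z - r i‖ < ‖z - r i‖ := fun i => by
    rw [← sq_lt_sq₀ (norm_nonneg _) (norm_nonneg _), Complex.sq_norm, Complex.sq_norm,
      Complex.normSq_apply, Complex.normSq_apply]
    simp only [Complex.sub_re, Complex.sub_im, Complex.conj_re, Complex.conj_im]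
    nlinarith [mul_pos_of_neg_of_neg hz (neg_lt_zero.mpr (hr0 i))]
  rw [hev, hev]
  refine mul_lt_mul_of_pos_left ?_ (norm_pos_iff.mpr hne)
  by_cases h0 : ∃ i, starRingEnd ℂ z = r i
  · obtain ⟨i, hi⟩ := h0
    rw [Finset.prod_eq_zero (Finset.mem_univ i) (by simp [hi])]
    exact Finset.prod_pos fun j _ => (norm_nonneg _).trans_lt (hlt j)
  · push Not at h0
    refine Finset.prod_lt_prod_of_nonempty (fun i _ => norm_pos_iff.mpr (sub_ne_zero.mpr (h0 i)))
      (fun i _ => hlt i) ?_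
    exact ⟨⟨0, Nat.pos_of_ne_zero hdeg⟩, Finset.mem_univ _⟩

theorem splits_of_subIMul {p r : ℝ[X]} (hdeg : (subIMul p r).natDegree ≠ 0)
    (h : ∀ z, (subIMul p r).eval z = 0 → 0 < z.im) : p.Splits := by
  have key : ∀ z : ℂ, aeval z p = 0 → ¬ z.im < 0 := fun z hz him => by
    have := norm_eval_conj_lt hdeg h him
    rw [eval_subIMul, eval_subIMul, aeval_conj, aeval_conj, hz] at this
    simp at this
  refine Splits.of_splits_map (algebraMap ℝ ℂ) (IsAlgClosed.splits _) fun z hz => ?_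
  have hz0 : aeval z p = 0 := by
    have := (mem_roots'.mp hz).2
    rwa [IsRoot, eval_map_algebraMap] at this
  have h1 := key z hz0
  have h2 := key (starRingEnd ℂ z) (by rw [aeval_conj, hz0, map_zero])
  rw [Complex.conj_im] at h2
  exact ⟨z.re, Complex.ext (by simp) (by simp; linarith)⟩

theorem derivative_mul_pos_of_subIMul {p r : ℝ[X]} (hdeg : (subIMul p r).natDegree ≠ 0)
    (h : ∀ z, (subIMul p r).eval z = 0 → 0 < z.im) {x : ℝ} (hx : p.eval x = 0) :
    0 < p.derivative.eval x * r.eval x := by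
  have hpx : ∀ s : ℝ[X], aeval (x : ℂ) s = ((s.eval x : ℝ) : ℂ) := fun s => by
    simpa using aeval_algebraMap_apply_eq_algebraMap_eval (A := ℂ) x s
  have hG : (subIMul p r).eval (x : ℂ) = - Complex.I * (r.eval x : ℝ) := by
    rw [eval_subIMul, hpx, hpx, hx]; simp
  have hG0 : (subIMul p r).eval (x : ℂ) ≠ 0 := fun h0 => by simpa using h _ h0
  have hr0 : r.eval x ≠ 0 := by
    rintro h0; rw [hG, h0] at hG0; simp at hG0
  have hG' : (subIMul p r).derivative.eval (x : ℂ) =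
      (p.derivative.eval x : ℝ) - Complex.I * (r.derivative.eval x : ℝ) := by
    rw [← hpx, ← hpx, ← eval_subIMul]
    simp [subIMul, derivative_map]
  have hs := (IsAlgClosed.splits (subIMul p r)).eval_derivative_div_eval_of_ne_zero hG0
  have him : 0 < ((subIMul p r).roots.map fun z ↦ 1 / ((x : ℂ) - z)).sum.im := by
    have hmap := map_multiset_sum Complex.imAddGroupHom
      ((subIMul p r).roots.map fun z ↦ 1 / ((x : ℂ) - z))
    rw [Complex.coe_imAddGroupHom] at hmap
    rw [hmap, Multiset.map_map]
    have hpos : ∀ z ∈ (subIMul p r).roots, 0 < (Complex.im ∘ fun z ↦ 1 / ((x : ℂ) - z)) z := by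
      intro z hz
      have hz0 := (mem_roots'.mp hz).2
      have hzi := h z hz0
      have : (x : ℂ) - z ≠ 0 := fun h0 => hG0 (by rw [sub_eq_zero.mp h0]; exact hz0)
      simp only [Function.comp, one_div, Complex.inv_im, Complex.sub_im, Complex.ofReal_im]
      exact div_pos (by linarith) (Complex.normSq_pos.mpr this)
    have hroots : (subIMul p r).roots ≠ 0 := (IsAlgClosed.splits _).roots_ne_zero hdeg
    obtain ⟨w, hw⟩ := Multiset.exists_mem_of_ne_zero hroots
    obtain ⟨t, ht⟩ := Multiset.exists_cons_of_mem hw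
    rw [ht] at hpos ⊢
    rw [Multiset.map_cons, Multiset.sum_cons]
    refine add_pos_of_pos_of_nonneg (hpos w (Multiset.mem_cons_self w t))
      (Multiset.sum_nonneg fun y hy => ?_)
    obtain ⟨u, hu, rfl⟩ := Multiset.mem_map.mp hy
    exact (hpos u (Multiset.mem_cons_of_mem hu)).le
  rw [← hs, hG, hG'] at him
  have : (((p.derivative.eval x : ℝ) - Complex.I * (r.derivative.eval x : ℝ)) /
      (- Complex.I * ((r.eval x : ℝ) : ℂ)) : ℂ) =
      (r.derivative.eval x / r.eval x : ℝ) + (p.derivative.eval x / r.eval x : ℝ) * Complex.I := by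
    have : ((r.eval x : ℝ) : ℂ) ≠ 0 := by exact_mod_cast hr0
    push_cast
    field_simp
    ring_nf
    simp
  rw [this] at him
  simp only [Complex.add_im, Complex.ofReal_im, Complex.mul_im, Complex.ofReal_re, Complex.I_im,
    Complex.I_re] at him
  have h2 := mul_pos him (sq_pos_of_ne_zero hr0)
  field_simp at h2
  linarith

theorem eval_derivative_C_mul_prod {n : ℕ} (a : ℝ) (lam : Fin n → ℝ) (i : Fin n) :
    (C a * ∏ j, (X - C (lam j))).derivative.eval (lam i) =
      a * ∏ j ∈ Finset.univ.erase i, (lam i - lam j) := by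
  have := Lagrange.eval_nodal_derivative_eval_node_eq (v := lam) (Finset.mem_univ i)
  rw [Lagrange.eval_nodal, Lagrange.nodal] at this
  rw [derivative_C_mul, eval_C_mul, this]

theorem im_pos_of_derivative_mul_pos {n : ℕ} {a : ℝ} (ha : 0 < a) (lam : Fin n → ℝ) {p r : ℝ[X]}
    (hp : p = C a * ∏ j, (X - C (lam j))) (hdeg : r.degree = p.degree)
    (hlead : r.leadingCoeff = p.leadingCoeff)
    (h : ∀ i, 0 < p.derivative.eval (lam i) * r.eval (lam i)) {z : ℂ}
    (hz : (subIMul p r).eval z = 0) : 0 < z.im := by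
  have hd : ∀ i, p.derivative.eval (lam i) = a * ∏ j ∈ Finset.univ.erase i, (lam i - lam j) := by
    rw [hp]; exact eval_derivative_C_mul_prod a lam
  have hinj : Function.Injective lam := fun i j hij => by
    by_contra hne
    have := h i
    rw [hd, Finset.prod_eq_zero (Finset.mem_erase.mpr ⟨Ne.symm hne, Finset.mem_univ j⟩)
      (sub_eq_zero.mpr hij)] at this
    simp at this
  have hev : ∀ (s : ℝ[X]) (x : ℝ), aeval (x : ℂ) s = ((s.eval x : ℝ) : ℂ) := fun s x => by
    simpa using aeval_algebraMap_apply_eq_algebraMap_eval (A := ℂ) x s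
  have hroot : ∀ i, p.eval (lam i) = 0 := fun i => by
    rw [hp, eval_mul, eval_prod, Finset.prod_eq_zero (Finset.mem_univ i) (by simp), mul_zero]
  rw [eval_subIMul] at hz
  by_cases hnode : ∃ i, z = lam i
  · obtain ⟨i, rfl⟩ := hnode
    have hi := h i
    rw [hev, hev, hroot] at hz
    simp at hz
    simp [hz] at hi
  push Not at hnode
  have hpdeg : p.degree = n := by
    rw [hp, degree_C_mul ha.ne']
    simpa [Lagrange.nodal] using Lagrange.degree_nodal (s := Finset.univ) (v := lam)
  have hp0 : p ≠ 0 := by rintro rfl; simp at hpdeg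
  have hr0 : r ≠ 0 := by rintro rfl; rw [← hdeg] at hpdeg; simp at hpdeg
  set v : Fin n → ℂ := fun i => (lam i : ℂ)
  have hint : (r - p).map (algebraMap ℝ ℂ) =
      Lagrange.interpolate Finset.univ v fun i => ((r.eval (lam i) : ℝ) : ℂ) := by
    refine Lagrange.eq_interpolate_of_eval_eq _ (fun i _ j _ hij => hinj (Complex.ofReal_injective hij))
      ?_ fun i _ => ?_
    · rw [degree_map, Finset.card_univ, Fintype.card_fin, ← hpdeg]
      exact degree_sub_lt_right hdeg hp0 hlead
    · rw [eval_map_algebraMap, hev, eval_sub, hroot, sub_zero]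
  have hz2 := congrArg (eval z) hint
  rw [Lagrange.eval_interpolate_not_at_node _ fun i _ => hnode i, eval_map_algebraMap, map_sub]
    at hz2
  have hN : (Lagrange.nodal Finset.univ v).eval z ≠ 0 :=
    Lagrange.eval_nodal_not_at_node fun i _ => hnode i
  have hpz : aeval z p = a * (Lagrange.nodal Finset.univ v).eval z := by
    rw [hp, Lagrange.eval_nodal]; simp [map_prod, v]
  set S : ℂ := ∑ i, Lagrange.nodalWeight Finset.univ v i * (z - v i)⁻¹ * ((r.eval (lam i) : ℝ) : ℂ)
  set N := (Lagrange.nodal Finset.univ v).eval z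
  have hS : S = -(a : ℂ) - Complex.I * a := by
    apply mul_left_cancel₀ hN
    rw [← hz2]
    linear_combination Complex.I * hz + aeval z r * Complex.I_sq - (1 + Complex.I) * hpz
  have hSim : S.im = -a := by rw [hS]; simp
  by_contra hneg
  have hle : 0 ≤ S.im := by
    simp only [S]
    rw [Complex.im_sum]
    refine Finset.sum_nonneg fun i _ => ?_
    have hw : Lagrange.nodalWeight Finset.univ v i =
        (((∏ j ∈ Finset.univ.erase i, (lam i - lam j))⁻¹ : ℝ) : ℂ) := by
      simp [Lagrange.nodalWeight, v]
    have hi := h i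
    rw [hd] at hi
    set D := ∏ j ∈ Finset.univ.erase i, (lam i - lam j)
    have hDr : 0 < D⁻¹ * r.eval (lam i) := by
      have : 0 < D * r.eval (lam i) := by
        rw [mul_assoc] at hi
        exact pos_of_mul_pos_right hi ha.le
      rw [mul_comm, ← div_eq_mul_inv, div_pos_iff]
      rw [mul_pos_iff] at this
      tauto
    have : Lagrange.nodalWeight Finset.univ v i * (z - v i)⁻¹ * ((r.eval (lam i) : ℝ) : ℂ) =
        ((D⁻¹ * r.eval (lam i) : ℝ) : ℂ) * (z - v i)⁻¹ := by
      rw [hw]; push_cast; ring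
    rw [this, Complex.im_ofReal_mul, Complex.inv_im]
    refine mul_nonneg hDr.le (div_nonneg ?_ (Complex.normSq_nonneg _))
    simp only [v, Complex.sub_im, Complex.ofReal_im]
    linarith
  linarith

theorem degree_reflection (p : ℝ[X]) : (reflection p).degree = p.degree := by
  rw [reflection, degree_C_mul (by simp), degree_comp_neg_X]

theorem leadingCoeff_reflection (p : ℝ[X]) : (reflection p).leadingCoeff = p.leadingCoeff := by
  rw [reflection, leadingCoeff_mul, comp_neg_X_leadingCoeff_eq, leadingCoeff_C, ← mul_assoc,
    ← mul_pow]
  simp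

theorem neg_one_pow_mul_prod_erase_sub_pos {n : ℕ} {x : Fin n → ℝ} (hx : StrictAnti x) (i : Fin n) :
    0 < (-1) ^ (i : ℕ) * ∏ j ∈ Finset.univ.erase i, (x i - x j) := by
  have h1 : (-1 : ℝ) ^ (i : ℕ) = ∏ j ∈ Finset.univ.erase i, if j < i then (-1 : ℝ) else 1 := by
    rw [← Finset.prod_filter, Finset.prod_const]
    congr 1
    rw [← Fin.card_Iio i]
    congr 1
    ext j
    simp only [Finset.mem_filter, Finset.mem_erase, Finset.mem_univ, Finset.mem_Iio]
    grind
  rw [h1, ← Finset.prod_mul_distrib]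
  refine Finset.prod_pos fun j hj => ?_
  rcases lt_or_gt_of_ne (Finset.ne_of_mem_erase hj) with hji | hji
  · have := hx hji
    rw [if_pos hji]; linarith
  · have := hx hji
    rw [if_neg hji.not_gt]; linarith

theorem derivative_mul_reflection {n : ℕ} {a : ℝ} (lam : Fin n → ℝ) {p : ℝ[X]}
    (hn : p.natDegree = n) (hp : p = C a * ∏ j, (X - C (lam j))) (i : Fin n) :
    p.derivative.eval (lam i) * (reflection p).eval (lam i) =
      2 * a ^ 2 * (lam i * ∏ j ∈ Finset.univ.erase i, (lam i ^ 2 - lam j ^ 2)) := by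
  have h1 : p.derivative.eval (lam i) = a * ∏ j ∈ Finset.univ.erase i, (lam i - lam j) := by
    rw [hp]; exact eval_derivative_C_mul_prod a lam i
  have h2 : (reflection p).eval (lam i) =
      a * (2 * lam i * ∏ j ∈ Finset.univ.erase i, (lam i + lam j)) := by
    have h3 : ∏ j, (-lam i - lam j) = (-1) ^ n * ∏ j, (lam i + lam j) := by
      have : (-1 : ℝ) ^ n = ∏ _j : Fin n, (-1 : ℝ) := by simp
      rw [this, ← Finset.prod_mul_distrib]
      exact Finset.prod_congr rfl fun j _ => by ring
    have h4 : p.eval (-lam i) = a * ∏ j, (-lam i - lam j) := by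
      rw [hp]; simp [eval_prod]
    rw [reflection, eval_mul, eval_C, eval_comp, eval_neg, eval_X, h4, h3, hn,
      ← Finset.mul_prod_erase _ _ (Finset.mem_univ i), two_mul]
    have : (-1 : ℝ) ^ n * (-1) ^ n = 1 := by rw [← mul_pow]; simp
    linear_combination (a * ((lam i + lam i) * ∏ j ∈ Finset.univ.erase i, (lam i + lam j))) * this
  have h5 : ∏ j ∈ Finset.univ.erase i, (lam i ^ 2 - lam j ^ 2) =
      (∏ j ∈ Finset.univ.erase i, (lam i - lam j)) * ∏ j ∈ Finset.univ.erase i, (lam i + lam j) := by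
    rw [← Finset.prod_mul_distrib]
    exact Finset.prod_congr rfl fun j _ => by ring
  rw [h1, h2, h5]
  ring

theorem selfInterlacingI_iff (p : ℝ[X]) : SelfInterlacingI p ↔
    ∃ lam : Fin p.natDegree → ℝ, p = C p.leadingCoeff * ∏ i, (X - C (lam i)) ∧
      ∀ i, 0 < lam i * ∏ j ∈ Finset.univ.erase i, (lam i ^ 2 - lam j ^ 2) := by
  have hsq : ∀ (m : ℕ), (-1 : ℝ) ^ m * (-1) ^ m = 1 := fun m => by rw [← mul_pow]; simp
  constructor
  · rintro ⟨lam, hp, hanti, hpos⟩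
    refine ⟨lam, hp, fun i => ?_⟩
    have hx : StrictAnti fun i => lam i ^ 2 := fun i j hij => by
      have h1 := pow_lt_pow_left₀ (hanti hij) (hpos j).le two_ne_zero
      simpa [mul_pow, ← pow_mul, mul_comm _ 2] using h1
    have := mul_pos (hpos i) (neg_one_pow_mul_prod_erase_sub_pos hx i)
    rwa [mul_mul_mul_comm, hsq, one_mul] at this
  · rintro ⟨lam, hp, hpos⟩
    have hinj : ∀ i j, |lam i| = |lam j| → i = j := fun i j hij => by
      by_contra hne
      have := hpos i
      rw [Finset.prod_eq_zero (Finset.mem_erase.mpr ⟨Ne.symm hne, Finset.mem_univ j⟩)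
        (sub_eq_zero.mpr (sq_eq_sq_iff_abs_eq_abs _ _ |>.mpr hij))] at this
      simp at this
    set σ := Tuple.sort fun i => -|lam i|
    have hmono : Monotone fun i => -|lam (σ i)| := Tuple.monotone_sort fun i => -|lam i|
    have hanti : StrictAnti fun i => |lam (σ i)| := fun i j hij => by
      refine lt_of_le_of_ne (by simpa using hmono hij.le) fun h => hij.ne' ?_
      exact σ.injective (hinj _ _ h)
    have hx : StrictAnti fun i => lam (σ i) ^ 2 := fun i j hij => sq_lt_sq.mpr (hanti hij)
    have hsign : ∀ i : Fin p.natDegree, 0 < (-1) ^ (i : ℕ) * lam (σ i) := fun i => by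
      have h1 := neg_one_pow_mul_prod_erase_sub_pos hx i
      have h2 := hpos (σ i)
      have h3 : ∏ j ∈ Finset.univ.erase (σ i), (lam (σ i) ^ 2 - lam j ^ 2) =
          ∏ j ∈ Finset.univ.erase i, (lam (σ i) ^ 2 - lam (σ j) ^ 2) := by
        symm
        refine Finset.prod_bij (fun j _ => σ j) (by simp) (by simp) (fun j hj => ?_) (by simp)
        exact ⟨σ.symm j, by simpa [Equiv.symm_apply_eq] using hj, by simp⟩
      rw [h3] at h2
      set D := ∏ j ∈ Finset.univ.erase i, (lam (σ i) ^ 2 - lam (σ j) ^ 2)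
      have h4 := mul_pos h1 h2
      have h5 : 0 < D ^ 2 := by
        refine sq_pos_of_ne_zero fun h0 => ?_
        rw [h0] at h2; simp at h2
      refine pos_of_mul_pos_left (b := D ^ 2) ?_ h5.le
      linarith
    have habs : ∀ i : Fin p.natDegree, (-1) ^ (i : ℕ) * lam (σ i) = |lam (σ i)| := fun i => by
      rw [← abs_of_pos (hsign i), abs_mul]; simp
    refine ⟨lam ∘ σ, ?_, ?_, hsign⟩
    · conv_lhs => rw [hp]
      congr 1
      exact (Equiv.prod_comp σ fun i => X - C (lam i)).symm
    · simpa only [Function.comp, habs] using hanti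

theorem one_sub_I_mul_sign (k : ℕ) :
    (1 - Complex.I) * (-1) ^ (k * (k + 1) / 2) = Complex.I ^ k * (1 - Complex.I * (-1) ^ k) := by
  induction k using Nat.strong_induction_on with
  | _ k ih =>
    match k with
    | 0 => simp
    | 1 => norm_num; linear_combination -Complex.I_sq
    | k + 2 =>
      have h : (k + 2) * (k + 2 + 1) / 2 = k * (k + 1) / 2 + 2 * k + 3 := by
        have : (k + 2) * (k + 2 + 1) = k * (k + 1) + 2 * (2 * k + 3) := by ring
        omega
      have h2 : (-1 : ℂ) ^ (2 * k) = 1 := by simp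
      rw [h, pow_add, pow_add, h2, pow_add, pow_add, Complex.I_sq]
      linear_combination -ih k (by omega)

theorem aeval_dualPoly (p : ℝ[X]) (z : ℂ) :
    (1 - Complex.I) * aeval (Complex.I * z) (dualPoly p) =
      Complex.I ^ p.natDegree * (subIMul p (reflection p)).eval z := by
  have h1 : ∀ w : ℂ, aeval w p = ∑ k ∈ Finset.range (p.natDegree + 1),
      (p.coeff (p.natDegree - k) : ℂ) * w ^ (p.natDegree - k) := fun w => by
    rw [aeval_eq_sum_range, ← Finset.sum_range_reflect]
    simp
  have h2 : aeval z (reflection p) = (-1) ^ p.natDegree * aeval (-z) p := by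
    simp [reflection, aeval_comp]
  rw [eval_subIMul, h2, h1, h1, dualPoly, map_sum]
  simp only [Finset.mul_sum, ← Finset.sum_sub_distrib]
  refine Finset.sum_congr rfl fun k hk => ?_
  obtain ⟨m, hm⟩ := Nat.exists_eq_add_of_le (Nat.lt_succ_iff.mp (Finset.mem_range.mp hk))
  have hs := one_sub_I_mul_sign k
  have hmk : p.natDegree - k = m := by omega
  have hm1 : (-1 : ℂ) ^ m * (-1) ^ m = 1 := by rw [← mul_pow]; simp
  simp only [hmk, map_mul, aeval_C, map_pow, aeval_X]
  rw [neg_pow z, hm, pow_add, pow_add, mul_pow]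
  simp only [map_neg, map_one, Complex.coe_algebraMap]
  linear_combination (p.coeff m * Complex.I ^ m * z ^ m : ℂ) * hs +
    (Complex.I ^ k * Complex.I ^ m * Complex.I * (-1) ^ k * p.coeff m * z ^ m : ℂ) * hm1

theorem hurwitzStable_dualPoly_iff (p : ℝ[X]) : HurwitzStable (dualPoly p) ↔
    ∀ z, (subIMul p (reflection p)).eval z = 0 → 0 < z.im := by
  have h1 : (1 - Complex.I) ≠ 0 := fun h => by simpa using congrArg Complex.re h
  have h : ∀ z, aeval (Complex.I * z) (dualPoly p) = 0 ↔
      (subIMul p (reflection p)).eval z = 0 := fun z => by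
    have := aeval_dualPoly p z
    rw [← mul_right_inj' h1, mul_zero, this]
    simp
  constructor
  · intro hq z hz
    simpa using hq _ ((h z).mpr hz)
  · intro hg w hw
    have hIw : Complex.I * (-Complex.I * w) = w := by linear_combination -w * Complex.I_sq
    simpa using hg (-Complex.I * w) ((h _).mp (by rwa [hIw]))

theorem natDegree_subIMul_reflection_ne_zero {p : ℝ[X]} (hp : p.natDegree ≠ 0) :
    (subIMul p (reflection p)).natDegree ≠ 0 := by
  have hp0 : p ≠ 0 := by rintro rfl; simp at hp
  have hr : (reflection p).coeff p.natDegree = p.leadingCoeff := by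
    rw [← leadingCoeff_reflection, leadingCoeff,
      natDegree_eq_of_degree_eq (degree_reflection p)]
  have hc : (subIMul p (reflection p)).coeff p.natDegree ≠ 0 := fun h => by
    have := congrArg Complex.re h
    simp [subIMul, hr, hp0] at this
  have := le_natDegree_of_ne_zero hc
  omega

/-- Duality: a real polynomial `p` of degree `n ≥ 1` with positive leading coefficient is
self-interlacing of kind I iff its dual polynomial
`q(z) = Σ_{k=0}^n (-1)^{k(k+1)/2} a_k z^{n-k}` is Hurwitz stable. -/
theorem selfInterlacing_iff_dual_hurwitzStable
    (n : ℕ) (hn : 1 ≤ n) (p : Polynomial ℝ)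
    (hdeg : p.natDegree = n) (hlead : 0 < p.leadingCoeff) :
    SelfInterlacingI p ↔ HurwitzStable (dualPoly p) := by
  have hfactor : ∀ {lam : Fin p.natDegree → ℝ},
      p = C p.leadingCoeff * ∏ i, (X - C (lam i)) → ∀ i,
        (0 < p.derivative.eval (lam i) * (reflection p).eval (lam i) ↔
          0 < lam i * ∏ j ∈ Finset.univ.erase i, (lam i ^ 2 - lam j ^ 2)) := fun hp i => by
    rw [derivative_mul_reflection _ rfl hp]
    exact mul_pos_iff_of_pos_left (by positivity)
  rw [selfInterlacingI_iff, hurwitzStable_dualPoly_iff]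
  constructor
  · rintro ⟨lam, hp, hpos⟩ z hz
    exact im_pos_of_derivative_mul_pos hlead lam hp (degree_reflection p)
      (leadingCoeff_reflection p) (fun i => (hfactor hp i).mpr (hpos i)) hz
  · intro h
    have hdeg' := natDegree_subIMul_reflection_ne_zero (p := p) (by omega)
    obtain ⟨lam, hp⟩ := exists_fin_prod_of_splits (splits_of_subIMul hdeg' h)
    refine ⟨lam, hp, fun i => (hfactor hp i).mp (derivative_mul_pos_of_subIMul hdeg' h ?_)⟩
    rw [hp, eval_mul, eval_prod, Finset.prod_eq_zero (Finset.mem_univ i) (by simp), mul_zero]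
end

section
/- (Stieltjes continued fraction criterion.) Let p be a real polynomial of degree n ≥ 1 with positive leading coefficient and associated function Φ. Then p is self-interlacing of kind I if and only if there exist real numbers c_1, …, c_n with (−1)^i c_i > 0 for i = 1, …, n such that Φ(u) equals the finite continued fraction 1/(c_1 u + 1/(c_2 + 1/(c_3 u + 1/(c_4 + ⋯ + 1/(c_n t_n(u))⋯)))), where t_i(u) = u for odd i and t_i(u) = 1 for even i, the equality holding as rational functions (i.e., at every u where both sides are defined). -/
open Polynomial

/-- The value of the tail of the Stieltjes-type continued fraction
`c_i t_i(u) + 1/(c_{i+1} t_{i+1}(u) + ⋯)` with `m + 1` remaining levels, where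
`t_i(u) = u` for odd `i` and `t_i(u) = 1` for even `i`. -/
noncomputable def cfVal (c : ℕ → ℝ) (u : ℝ) : ℕ → ℕ → ℝ
  | i, 0 => c i * (if Odd i then u else 1)
  | i, m + 1 => c i * (if Odd i then u else 1) + 1 / cfVal c u (i + 1) m

open scoped ComplexConjugate

/-- A pair of real polynomials whose Bezoutian-type kernel
`(P(x) Q(y) - P(y) Q(x)) / (x - y)` has the sign of `σ` at conjugate arguments. -/
structure DefinitePair (σ : ℝ) (P Q : ℝ[X]) : Prop where
  im_pos : ∀ z : ℂ, z.im ≠ 0 → 0 < σ * z.im * (aeval z P * conj (aeval z Q)).im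
  wronskian_pos : ∀ x : ℝ,
    0 < σ * ((derivative P).eval x * Q.eval x - P.eval x * (derivative Q).eval x)

namespace DefinitePair

variable {σ τ : ℝ} {P Q : ℝ[X]}

theorem linearComb (h : DefinitePair σ P Q) (a b c d : ℝ)
    (hdet : 0 < τ * σ * (a * d - b * c)) :
    DefinitePair τ (C a * P + C b * Q) (C c * P + C d * Q) := by
  have hσ : 0 < σ ^ 2 := by
    have : σ ≠ 0 := by rintro rfl; simp at hdet
    positivity
  refine ⟨fun z hz => ?_, fun x => ?_⟩
  · have h1 := mul_pos hdet (h.im_pos z hz)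
    refine (mul_pos_iff_of_pos_left hσ).1 ?_
    refine h1.trans_eq ?_
    simp [Complex.mul_im, Complex.mul_re]
    ring
  · have h1 := mul_pos hdet (h.wronskian_pos x)
    refine (mul_pos_iff_of_pos_left hσ).1 ?_
    refine h1.trans_eq ?_
    simp
    ring

theorem swap (h : DefinitePair σ P Q) : DefinitePair (-σ) Q P := by
  have hσ : σ ≠ 0 := by rintro rfl; simpa using h.wronskian_pos 0
  have h2 : 0 < σ ^ 2 := by positivity
  simpa using h.linearComb (τ := -σ) 0 1 1 0 (by linarith [sq σ])

theorem ne_zero (h : DefinitePair σ P Q) : P ≠ 0 := by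
  rintro rfl
  simpa using h.wronskian_pos 0

/-- The first member of a definite pair has only real and simple roots. -/
theorem exists_eq_nodal (h : DefinitePair σ P Q) :
    ∃ v : Fin P.natDegree → ℝ, Function.Injective v ∧
      P = C P.leadingCoeff * Lagrange.nodal Finset.univ v := by
  have hs : P.Splits := by
    refine Splits.of_splits_map (algebraMap ℝ ℂ) (IsAlgClosed.splits _) fun z hz => ?_
    have hz0 : aeval z P = 0 := by
      rw [aeval_def, ← eval_map]
      exact (mem_roots'.1 hz).2
    have : z.im = 0 := by
      by_contra hne
      simpa [hz0] using h.im_pos z hne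
    exact ⟨z.re, Complex.ext rfl (by simp [this])⟩
  have hnd : P.roots.Nodup := by
    rw [Multiset.nodup_iff_count_le_one]
    intro a
    rw [count_roots]
    by_contra! hlt
    obtain ⟨h1, h2⟩ := (one_lt_rootMultiplicity_iff_isRoot h.ne_zero).1 hlt
    simpa [h1.eq_zero, h2.eq_zero] using h.wronskian_pos a
  have hcard := hs.natDegree_eq_card_roots
  have hcard' : Fintype.card {x // x ∈ P.roots.toFinset} = P.natDegree := by
    rw [Fintype.card_coe, Multiset.toFinset_card_of_nodup hnd, hcard]
  let e := (Fintype.equivFinOfCardEq hcard').symm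
  refine ⟨fun i => (e i : ℝ), Subtype.val_injective.comp e.injective, ?_⟩
  conv_lhs => rw [hs.eq_prod_roots]
  congr 1
  rw [Lagrange.nodal_eq, e.prod_comp (fun x => X - C (x : ℝ)), 
    Finset.prod_coe_sort _ (fun x => X - C x), Finset.prod, Multiset.toFinset_val, hnd.dedup]

end DefinitePair

open Lagrange in
/-- Lagrange interpolation at the nodes `v`, in unnormalised form. -/
theorem eq_sum_nodal_erase {n : ℕ} {v : Fin n → ℝ} (hv : Function.Injective v) {Q : ℝ[X]}
    (hQ : Q.degree < n) :
    Q = ∑ i, C (Q.eval (v i) / (nodal (Finset.univ.erase i) v).eval (v i)) *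
      nodal (Finset.univ.erase i) v := by
  refine eq_of_degrees_lt_of_eval_index_eq Finset.univ hv.injOn (by simpa using hQ) ?_ ?_
  · refine (degree_sum_le _ _).trans_lt ((Finset.sup_lt_iff (by simp)).2 fun i _ => ?_)
    rw [← smul_eq_C_mul]
    refine (degree_smul_le _ _).trans_lt ?_
    rw [degree_nodal]
    exact_mod_cast Finset.card_erase_lt_of_mem (Finset.mem_univ i)
  · intro i _
    rw [eval_finsetSum, Finset.sum_eq_single i]
    · rw [eval_mul, eval_C, div_mul_cancel₀]
      refine eval_nodal_not_at_node fun j hj => ?_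
      exact fun h => (Finset.mem_erase.1 hj).1 (hv h.symm)
    · intro j _ hji
      rw [eval_mul, eval_nodal_at_node (i := i) (by simp [hji.symm]), mul_zero]
    · simp

open Lagrange in
/-- If `σ P' Q > 0` at all roots of the polynomial `P` with only real simple roots, then
`(P, Q)` is a definite pair. -/
theorem DefinitePair.of_nodal {n : ℕ} {v : Fin n → ℝ} (hv : Function.Injective v) (hn : n ≠ 0)
    {k σ : ℝ} {Q : ℝ[X]} (hQ : Q.degree < n)
    (hpos : ∀ i, 0 < σ * ((derivative (C k * nodal Finset.univ v)).eval (v i) * Q.eval (v i))) :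
    DefinitePair σ (C k * nodal Finset.univ v) Q := by
  set s : Fin n → ℝ := fun i => Q.eval (v i) / (nodal (Finset.univ.erase i) v).eval (v i) with hs
  have hQs : Q = ∑ i, C (s i) * nodal (Finset.univ.erase i) v := eq_sum_nodal_erase hv hQ
  have hw : ∀ i, 0 < σ * k * s i := by
    intro i
    have := hpos i
    rw [derivative_C_mul, eval_mul, eval_C,
      eval_nodal_derivative_eval_node_eq (Finset.mem_univ i)] at this
    have hne : (nodal (Finset.univ.erase i) v).eval (v i) ≠ 0 := by
      intro h0; simp [h0] at this
    have h2 : 0 < ((nodal (Finset.univ.erase i) v).eval (v i)) ^ 2 := by positivity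
    refine (mul_pos_iff_of_pos_right h2).1 ?_
    refine this.trans_eq ?_
    simp only [hs]
    field_simp
  have hfac : ∀ i, nodal Finset.univ v = (X - C (v i)) * nodal (Finset.univ.erase i) v :=
    fun i => nodal_eq_mul_nodal_erase (Finset.mem_univ i)
  have : Nonempty (Fin n) := ⟨⟨0, Nat.pos_of_ne_zero hn⟩⟩
  refine ⟨fun z hz => ?_, fun x => ?_⟩
  · have key : σ * z.im * (aeval z (C k * nodal Finset.univ v) * conj (aeval z Q)).im =
        ∑ i, (σ * k * s i) *
          (z.im ^ 2 * Complex.normSq (aeval z (nodal (Finset.univ.erase i) v))) := by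
      conv_lhs => rw [hQs]
      rw [map_sum, map_sum, Finset.mul_sum, Complex.im_sum, Finset.mul_sum]
      refine Finset.sum_congr rfl fun i _ => ?_
      rw [hfac i]
      simp [Complex.mul_im, Complex.mul_re, Complex.normSq_apply]
      ring
    rw [key]
    refine Finset.sum_pos (fun i _ => mul_pos (hw i) (mul_pos (by positivity) ?_))
      Finset.univ_nonempty
    rw [Complex.normSq_pos, nodal_eq, map_prod, Finset.prod_ne_zero_iff]
    intro j _ h0
    apply hz
    have := congrArg Complex.im h0
    simpa using this
  · have key : σ * ((derivative (C k * nodal Finset.univ v)).eval x * Q.eval x -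
          (C k * nodal Finset.univ v).eval x * (derivative Q).eval x) =
        ∑ i, (σ * k * s i) * ((nodal (Finset.univ.erase i) v).eval x) ^ 2 := by
      conv_lhs => rw [hQs]
      rw [derivative_sum, eval_finsetSum, eval_finsetSum, Finset.mul_sum, Finset.mul_sum,
        ← Finset.sum_sub_distrib, Finset.mul_sum]
      refine Finset.sum_congr rfl fun i _ => ?_
      rw [hfac i]
      simp
      ring
    rw [key]
    obtain ⟨i, hi⟩ : ∃ i, (nodal (Finset.univ.erase i) v).eval x ≠ 0 := by
      by_cases hx : ∃ i, x = v i
      · obtain ⟨i, rfl⟩ := hx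
        exact ⟨i, eval_nodal_not_at_node fun j hj h => (Finset.mem_erase.1 hj).1 (hv h.symm)⟩
      · push Not at hx
        exact ⟨Classical.arbitrary _, eval_nodal_not_at_node fun j _ => hx j⟩
    refine Finset.sum_pos' (fun i _ => mul_nonneg (hw i).le (sq_nonneg _))
      ⟨i, Finset.mem_univ i, mul_pos (hw i) (by positivity)⟩

open Lagrange in
/-- In a definite pair `(P, Q)` with `deg Q < deg P`, the degrees differ by one. -/
theorem DefinitePair.leadingCoeff_mul_coeff_pos {σ : ℝ} {P Q : ℝ[X]} (h : DefinitePair σ P Q)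
    {n : ℕ} (hP : P.natDegree = n + 1) (hQ : Q.degree < (n + 1 : ℕ)) :
    0 < σ * (P.leadingCoeff * Q.coeff n) := by
  obtain ⟨v, hv, hPv⟩ := h.exists_eq_nodal
  rw [← hP] at hQ
  set k := P.leadingCoeff
  have hcoeff : Q.coeff n =
      ∑ i, Q.eval (v i) / (nodal (Finset.univ.erase i) v).eval (v i) := by
    conv_lhs => rw [eq_sum_nodal_erase hv hQ]
    rw [finsetSum_coeff]
    refine Finset.sum_congr rfl fun i _ => ?_
    have hd : (nodal (Finset.univ.erase i) v).natDegree = n := by simp [hP]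
    have hm : (nodal (Finset.univ.erase i) v).Monic := nodal_monic
    rw [coeff_C_mul, ← hd, hm.coeff_natDegree, mul_one]
  have : Nonempty (Fin P.natDegree) := ⟨⟨0, by omega⟩⟩
  rw [hcoeff, Finset.mul_sum, Finset.mul_sum]
  refine Finset.sum_pos (fun i _ => ?_) Finset.univ_nonempty
  have hw := h.wronskian_pos (v i)
  have hroot : P.eval (v i) = 0 := by
    rw [hPv, eval_mul, eval_nodal_at_node (Finset.mem_univ i), mul_zero]
  have hder : (derivative P).eval (v i) = k * (nodal (Finset.univ.erase i) v).eval (v i) := by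
    conv_lhs => rw [hPv]
    rw [derivative_C_mul, eval_mul, eval_C,
      eval_nodal_derivative_eval_node_eq (Finset.mem_univ i)]
  rw [hroot, hder, zero_mul, sub_zero] at hw
  have hne : (nodal (Finset.univ.erase i) v).eval (v i) ≠ 0 := by
    intro h0; simp [h0] at hw
  have h2 : 0 < ((nodal (Finset.univ.erase i) v).eval (v i)) ^ 2 := by positivity
  refine (mul_pos_iff_of_pos_right h2).1 ?_
  refine hw.trans_eq ?_
  field_simp

/-- Numerator and denominator polynomials of the finite continued fraction
`c i * t i + 1 / (c (i + 1) * t (i + 1) + ⋯)` with `m` levels. -/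
noncomputable def cfPoly (t : ℕ → ℝ[X]) (c : ℕ → ℝ) : ℕ → ℕ → ℝ[X] × ℝ[X]
  | _, 0 => (1, 0)
  | i, m + 1 => (C (c i) * t i * (cfPoly t c (i + 1) m).1 + (cfPoly t c (i + 1) m).2,
      (cfPoly t c (i + 1) m).1)

/-- The partial denominators `t i` of a Stieltjes continued fraction. -/
noncomputable def stieltjesTerm (i : ℕ) : ℝ[X] := if Odd i then X else 1

/-- The numerator and denominator with all `t i` equal to the variable. -/
noncomputable abbrev cfPolyX (c : ℕ → ℝ) : ℕ → ℕ → ℝ[X] × ℝ[X] := cfPoly (fun _ => X) c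

/-- The numerator and denominator of the Stieltjes continued fraction. -/
noncomputable abbrev cfPolyS (c : ℕ → ℝ) : ℕ → ℕ → ℝ[X] × ℝ[X] := cfPoly stieltjesTerm c

theorem cfPoly_congr (t : ℕ → ℝ[X]) {c d : ℕ → ℝ} (m : ℕ) :
    ∀ i, (∀ j, i ≤ j → c j = d j) → cfPoly t c i m = cfPoly t d i m := by
  induction m with
  | zero => intro i _; rfl
  | succ m ih =>
    intro i h
    simp only [cfPoly]
    rw [ih (i + 1) fun j hj => h j (by omega), h i le_rfl]

theorem isCoprime_cfPoly (t : ℕ → ℝ[X]) (c : ℕ → ℝ) (m : ℕ) :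
    ∀ i, IsCoprime (cfPoly t c i m).1 (cfPoly t c i m).2 := by
  induction m with
  | zero => intro i; exact isCoprime_one_left
  | succ m ih =>
    intro i
    simp only [cfPoly]
    have := (ih (i + 1)).symm.add_mul_right_left (C (c i) * t i)
    rwa [add_comm] at this

theorem degree_cfPolyX (c : ℕ → ℝ) (m : ℕ) :
    ∀ i, (∀ j, i ≤ j → j < i + m → c j ≠ 0) →
      (cfPolyX c i m).1.degree = m ∧ (cfPolyX c i m).2.degree < m := by
  induction m with
  | zero => intro i _; simp [cfPoly]
  | succ m ih =>
    intro i h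
    obtain ⟨h1, h2⟩ := ih (i + 1) fun j hj hj' => h j (by omega) (by omega)
    have h3 : (C (c i) * X * (cfPolyX c (i + 1) m).1).degree = ((m + 1 : ℕ) : WithBot ℕ) := by
      rw [mul_assoc, degree_C_mul (h i le_rfl (by omega)), degree_mul, degree_X, h1]
      push_cast; ring
    have h4 : (m : WithBot ℕ) < ((m + 1 : ℕ) : WithBot ℕ) := by exact_mod_cast Nat.lt_succ_self m
    simp only [cfPoly]
    refine ⟨?_, by rw [h1]; exact h4⟩
    rw [degree_add_eq_left_of_degree_lt, h3]
    rw [h3]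
    exact h2.trans h4

theorem definitePair_cfPolyX (c : ℕ → ℝ) (m : ℕ) :
    ∀ i, (∀ j, i ≤ j → j < i + (m + 1) → 0 < (-1 : ℝ) ^ j * c j) →
      DefinitePair ((-1) ^ i) (cfPolyX c i (m + 1)).1 (cfPolyX c i (m + 1)).2 := by
  induction m with
  | zero =>
    intro i h
    have hi := h i le_rfl (by omega)
    refine ⟨fun z hz => ?_, fun x => ?_⟩
    · have : 0 < z.im ^ 2 := by positivity
      refine (mul_pos hi this).trans_eq ?_
      simp [cfPoly]
      ring
    · simpa [cfPoly] using hi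
  | succ m ih =>
    intro i h
    have hi := h i le_rfl (by omega)
    obtain ⟨h1, h2⟩ := ih (i + 1) fun j hj hj' => h j (by omega) (by omega)
    set P := (cfPolyX c (i + 1) (m + 1)).1 with hP
    set Q := (cfPolyX c (i + 1) (m + 1)).2 with hQ
    have e1 : (cfPolyX c i (m + 1 + 1)).1 = C (c i) * X * P + Q := rfl
    have e2 : (cfPolyX c i (m + 1 + 1)).2 = P := rfl
    rw [e1, e2]
    refine ⟨fun z hz => ?_, fun x => ?_⟩
    · have h3 := mul_nonneg hi.le (mul_nonneg (sq_nonneg z.im) (Complex.normSq_nonneg (aeval z P)))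
      refine (add_pos_of_nonneg_of_pos h3 (h1 z hz)).trans_eq ?_
      simp [Complex.mul_im, Complex.mul_re, Complex.normSq_apply, pow_succ]
      ring
    · have h3 := mul_nonneg hi.le (sq_nonneg (P.eval x))
      refine (add_pos_of_nonneg_of_pos h3 (h2 x)).trans_eq ?_
      simp [pow_succ]
      ring

/-- Euclid's algorithm on a definite pair of polynomials of opposite parities yields a
continued fraction with coefficients of alternating signs. -/
theorem exists_cfPolyX_eq (n : ℕ) : ∀ (i : ℕ) (A B : ℝ[X]), A.degree = n → B.degree < n →
    (∀ j, Odd (n + j) → A.coeff j = 0) → (∀ j, Even (n + j) → B.coeff j = 0) →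
    (n ≠ 0 → DefinitePair ((-1) ^ i) A B) →
    ∃ (c : ℕ → ℝ) (k : ℝ), k ≠ 0 ∧ (∀ j, i ≤ j → j < i + n → 0 < (-1 : ℝ) ^ j * c j) ∧
      A = C k * (cfPolyX c i n).1 ∧ B = C k * (cfPolyX c i n).2 := by
  induction n with
  | zero =>
    intro i A B hA hB _ _ _
    have hB0 : B = 0 := by
      rw [← degree_eq_bot]
      exact Nat.WithBot.lt_zero_iff.1 hB
    have hA0 := eq_C_of_degree_eq_zero hA
    refine ⟨0, A.coeff 0, ?_, by omega, ?_, ?_⟩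
    · intro h0
      rw [h0, C_0] at hA0
      simp [hA0] at hA
    · simpa [cfPoly] using hA0
    · simp [cfPoly, hB0]
  | succ n ih =>
    intro i A B hA hB hAp hBp hdef
    have hdef := hdef n.succ_ne_zero
    have hAn : A.natDegree = n + 1 := natDegree_eq_of_degree_eq_some hA
    have hlc := hdef.leadingCoeff_mul_coeff_pos hAn hB
    have hlcA : A.leadingCoeff = A.coeff (n + 1) := by rw [leadingCoeff, hAn]
    set a := A.leadingCoeff
    set b := B.coeff n
    have hb : b ≠ 0 := by rintro h; simp [h] at hlc
    have hBdeg : B.degree = n := by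
      refine le_antisymm (Order.lt_succ_iff.1 (by exact_mod_cast hB)) (le_degree_of_ne_zero hb)
    set D := A - C (a / b) * X * B with hD
    have hA' : A = C (a / b) * X * B + D := by rw [hD]; ring
    have hDcoeff : ∀ j, D.coeff (j + 1) = A.coeff (j + 1) - a / b * B.coeff j := by
      intro j
      rw [hD, coeff_sub, mul_assoc, coeff_C_mul, coeff_X_mul]
    have hDp : ∀ j, Even (n + j) → D.coeff j = 0 := by
      intro j hj
      cases j with
      | zero =>
        rw [hD, coeff_sub, mul_assoc, coeff_C_mul, coeff_X_mul_zero, hAp 0 (by grind)]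
        simp
      | succ j => rw [hDcoeff, hAp _ (by grind), hBp _ (by grind)]; simp
    have hDdeg : D.degree < n := by
      rw [degree_lt_iff_coeff_zero]
      intro j hj
      rcases hj.eq_or_lt with rfl | hj
      · exact hDp _ (by grind)
      obtain ⟨j, rfl⟩ : ∃ l, j = l + 1 := ⟨j - 1, by omega⟩
      rw [hDcoeff]
      rcases (Nat.lt_succ_iff.1 hj).eq_or_lt with rfl | hj
      · rw [← hlcA]
        change a - a / b * b = 0
        field_simp
        simp
      · rw [coeff_eq_zero_of_degree_lt (n := j + 1), coeff_eq_zero_of_degree_lt (n := j)]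
        · simp
        · rw [hBdeg]; exact_mod_cast hj
        · rw [hA]; exact_mod_cast Nat.succ_lt_succ hj
    have hBD : n ≠ 0 → DefinitePair ((-1) ^ (i + 1)) B D := by
      intro hn
      have hBn : B.natDegree = n := natDegree_eq_of_degree_eq_some hBdeg
      obtain ⟨v, hv, hBv⟩ := hdef.swap.exists_eq_nodal
      have hroot : ∀ l, B.eval (v l) = 0 := by
        intro l
        rw [hBv, eval_mul, Lagrange.eval_nodal_at_node (Finset.mem_univ l), mul_zero]
      rw [hBv]
      refine DefinitePair.of_nodal hv (by omega) (by rw [hBn]; exact hDdeg) fun l => ?_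
      rw [← hBv]
      have hw := hdef.wronskian_pos (v l)
      have hDA : D.eval (v l) = A.eval (v l) := by simp [hD, hroot l]
      rw [hroot l] at hw
      rw [hDA]
      refine hw.trans_eq ?_
      ring
    obtain ⟨c, k, hk, hc, h1, h2⟩ := ih (i + 1) B D hBdeg hDdeg
      (fun j hj => hBp j (by grind)) hDp hBD
    have hcongr := cfPoly_congr (fun _ => X) (c := fun j => if j = i then a / b else c j) (d := c)
      n (i + 1) fun j hj => if_neg (by omega)
    refine ⟨fun j => if j = i then a / b else c j, k, hk, fun j hj hj' => ?_, ?_, ?_⟩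
    · by_cases hji : j = i
      · subst hji
        have hb2 : 0 < b ^ 2 := by positivity
        simp only [if_pos]
        refine (mul_pos_iff_of_pos_right hb2).1 (hlc.trans_eq ?_)
        field_simp
      · simpa only [if_neg hji] using hc j (by omega) (by omega)
    · simp only [cfPolyX, cfPoly, hcongr, if_pos]
      rw [hA']
      conv_lhs => rw [h2]
      conv_lhs => enter [1]; rw [h1]
      ring
    · simp only [cfPolyX, cfPoly, hcongr]
      exact h1

theorem StrictAnti.neg_one_pow_mul_prod_erase_pos {n : ℕ} {μ : Fin n → ℝ} (hμ : StrictAnti μ)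
    (i : Fin n) : 0 < (-1) ^ (i : ℕ) * ∏ j ∈ Finset.univ.erase i, (μ i - μ j) := by
  have hsign : (-1 : ℝ) ^ (i : ℕ) =
      ∏ j ∈ Finset.univ.erase i, if j < i then (-1 : ℝ) else 1 := by
    rw [Finset.prod_ite, Finset.prod_const, Finset.prod_const_one, mul_one]
    congr 1
    rw [← Fin.card_Iio i]
    congr 1
    ext j
    simp only [Finset.mem_Iio, Finset.mem_filter, Finset.mem_erase, Finset.mem_univ, and_true]
    exact ⟨fun h => ⟨h.ne, h⟩, fun h => h.2⟩
  rw [hsign, ← Finset.prod_mul_distrib]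
  refine Finset.prod_pos fun j hj => ?_
  rcases lt_or_gt_of_ne (Finset.mem_erase.1 hj).1 with h | h
  · rw [if_pos h]
    linarith [hμ h]
  · rw [if_neg h.le.not_gt]
    linarith [hμ h]

theorem derivative_mul_reflection_eval_node {n : ℕ} {v : Fin n → ℝ} {k : ℝ} {q : ℝ[X]}
    (hq : ∀ x, q.eval x = (-1) ^ n * (C k * Lagrange.nodal Finset.univ v).eval (-x))
    (i : Fin n) :
    (derivative (C k * Lagrange.nodal Finset.univ v)).eval (v i) * q.eval (v i) =
      2 * k ^ 2 * (v i * ∏ j ∈ Finset.univ.erase i, (v i ^ 2 - v j ^ 2)) := by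
  have h1 : (-1 : ℝ) ^ n * ∏ j, (-v i - v j) = ∏ j, (v i + v j) := by
    have : (-1 : ℝ) ^ n = ∏ _j : Fin n, (-1 : ℝ) := by simp
    rw [this, ← Finset.prod_mul_distrib]
    exact Finset.prod_congr rfl fun j _ => by ring
  have h2 : ∏ j ∈ Finset.univ.erase i, (v i ^ 2 - v j ^ 2) =
      (∏ j ∈ Finset.univ.erase i, (v i - v j)) * ∏ j ∈ Finset.univ.erase i, (v i + v j) := by
    rw [← Finset.prod_mul_distrib]
    exact Finset.prod_congr rfl fun j _ => by ring
  rw [hq, derivative_C_mul, eval_mul, eval_C, eval_mul, eval_C,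
    Lagrange.eval_nodal_derivative_eval_node_eq (Finset.mem_univ i), Lagrange.eval_nodal,
    Lagrange.eval_nodal, mul_left_comm ((-1) ^ n), h1, h2,
    ← Finset.mul_prod_erase _ _ (Finset.mem_univ i)]
  ring

theorem definitePair_of_selfInterlacingI {p A B : ℝ[X]} (hp : p.natDegree ≠ 0) (hAB : p = A + B)
    (hB : B.degree < p.natDegree)
    (hrefl : ∀ x, (A - B).eval x = (-1) ^ p.natDegree * p.eval (-x))
    (h : SelfInterlacingI p) : DefinitePair (-1) A B := by
  obtain ⟨v, hpv, hanti, hpos⟩ := h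
  rw [← Lagrange.nodal_eq] at hpv
  have hk : p.leadingCoeff ≠ 0 :=
    leadingCoeff_ne_zero.2 fun h0 => hp (by rw [h0, natDegree_zero])
  have hsq : ∀ i : Fin p.natDegree, ((-1 : ℝ) ^ (i : ℕ) * v i) ^ 2 = v i ^ 2 := fun i => by
    rw [mul_pow, ← pow_mul, mul_comm (i : ℕ), pow_mul, neg_one_sq, one_pow, one_mul]
  have hanti2 : StrictAnti fun i => v i ^ 2 := fun i j hij => by
    simp only
    rw [← hsq i, ← hsq j]
    exact pow_lt_pow_left₀ (hanti hij) (hpos j).le two_ne_zero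
  have hinj : Function.Injective v := fun i j hij =>
    hanti2.injective (congrArg (fun x => x ^ 2) hij)
  have hnodal : DefinitePair 1 p (C (-2) * B) := by
    have := DefinitePair.of_nodal (k := p.leadingCoeff) (σ := 1) (Q := C (-2) * B) hinj hp
      (by rwa [degree_C_mul (by norm_num)]) fun i => ?_
    · rwa [← hpv] at this
    have hroot : p.eval (v i) = 0 := by
      rw [hpv, eval_mul, Lagrange.eval_nodal_at_node (Finset.mem_univ i), mul_zero]
    have hBq : (C (-2) * B).eval (v i) = (A - B).eval (v i) := by
      rw [hAB, eval_add] at hroot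
      rw [eval_mul, eval_C, eval_sub]
      linarith
    rw [hBq, derivative_mul_reflection_eval_node (fun x => by rw [hrefl, ← hpv]), one_mul]
    have := mul_pos (hpos i) (hanti2.neg_one_pow_mul_prod_erase_pos i)
    rw [mul_mul_mul_comm, ← mul_pow, neg_one_mul, neg_neg, one_pow, one_mul] at this
    positivity
  have := hnodal.linearComb (τ := -1) 1 (1 / 2) 0 (-1 / 2) (by norm_num)
  convert this using 1
  · rw [hAB, ← mul_assoc, ← C_mul]
    norm_num
  · rw [← mul_assoc, ← C_mul]
    norm_num

theorem selfInterlacingI_of_definitePair {p A B : ℝ[X]} (hAB : p = A + B)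
    (hrefl : ∀ x, (A - B).eval x = (-1) ^ p.natDegree * p.eval (-x))
    (h : DefinitePair (-1) A B) : SelfInterlacingI p := by
  have hpq : DefinitePair 1 p (A - B) := by
    convert h.linearComb (τ := 1) 1 1 1 (-1) (by norm_num) using 1
    · rw [hAB]; simp
    · simp [sub_eq_add_neg]
  obtain ⟨v, hv, hpv⟩ := hpq.exists_eq_nodal
  set s := Tuple.sort fun i => -|v i|
  have hmono : Monotone fun i => -|v (s i)| := Tuple.monotone_sort fun i => -|v i|
  set w : Fin p.natDegree → ℝ := fun i => v (s i)
  have hpw : p = C p.leadingCoeff * Lagrange.nodal Finset.univ w := by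
    conv_lhs => rw [hpv]
    rw [Lagrange.nodal_eq, Lagrange.nodal_eq, ← Equiv.prod_comp s]
  have hprod : ∀ i, 0 < w i * ∏ j ∈ Finset.univ.erase i, (w i ^ 2 - w j ^ 2) := by
    intro i
    have hw := hpq.wronskian_pos (w i)
    have hroot : p.eval (w i) = 0 := by
      rw [hpw, eval_mul, Lagrange.eval_nodal_at_node (Finset.mem_univ i), mul_zero]
    have hder := derivative_mul_reflection_eval_node (v := w) (k := p.leadingCoeff)
      (fun x => by rw [hrefl, ← hpw]) i
    rw [← hpw] at hder
    rw [hroot, zero_mul, sub_zero, one_mul, hder] at hw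
    exact (mul_pos_iff_of_pos_left (by
      have := leadingCoeff_ne_zero.2 hpq.ne_zero
      positivity)).1 hw
  have habs : StrictAnti fun i => |w i| := by
    intro i j hij
    refine lt_of_le_of_ne (neg_le_neg_iff.1 (hmono hij.le)) fun heq => ?_
    have h0 : ∏ l ∈ Finset.univ.erase i, (w i ^ 2 - w l ^ 2) = 0 :=
      Finset.prod_eq_zero (i := j) (by simp [hij.ne'])
        (by rw [← sq_abs (w i), ← sq_abs (w j), sub_eq_zero]; simp only [heq])
    simpa [h0] using hprod i
  have hanti2 : StrictAnti fun i => w i ^ 2 := fun i j hij => by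
    simp only [← sq_abs (w _)]
    exact pow_lt_pow_left₀ (habs hij) (abs_nonneg _) two_ne_zero
  have hsign : ∀ i : Fin p.natDegree, 0 < (-1 : ℝ) ^ (i : ℕ) * w i := by
    intro i
    have h1 := mul_pos (hprod i) (hanti2.neg_one_pow_mul_prod_erase_pos i)
    have h2 := sq_nonneg (∏ l ∈ Finset.univ.erase i, (w i ^ 2 - w l ^ 2))
    refine pos_of_mul_pos_left (h1.trans_eq ?_) h2
    ring
  have heq : (fun i : Fin p.natDegree => (-1 : ℝ) ^ (i : ℕ) * w i) = fun i => |w i| := by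
    funext i
    rw [← abs_of_pos (hsign i), abs_mul, abs_pow, abs_neg, abs_one, one_pow, one_mul]
  exact ⟨w, by rwa [← Lagrange.nodal_eq], heq ▸ habs, hsign⟩

theorem comp_sq_cfPolyS (c : ℕ → ℝ) (m : ℕ) : ∀ i,
    (Odd i → Even m → (cfPolyS c i m).1.comp (X ^ 2) = (cfPolyX c i m).1 ∧
      X * (cfPolyS c i m).2.comp (X ^ 2) = (cfPolyX c i m).2) ∧
    (Even i → Odd m → X * (cfPolyS c i m).1.comp (X ^ 2) = (cfPolyX c i m).1 ∧
      (cfPolyS c i m).2.comp (X ^ 2) = (cfPolyX c i m).2) ∧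
    (Odd i → Odd m → (cfPolyS c i m).1.comp (X ^ 2) = X * (cfPolyX c i m).1 ∧
      (cfPolyS c i m).2.comp (X ^ 2) = (cfPolyX c i m).2) ∧
    (Even i → Even m → (cfPolyS c i m).1.comp (X ^ 2) = (cfPolyX c i m).1 ∧
      (cfPolyS c i m).2.comp (X ^ 2) = X * (cfPolyX c i m).2) := by
  induction m with
  | zero => intro i; simp [cfPoly]
  | succ m ih =>
    intro i
    obtain ⟨h1, h2, h3, h4⟩ := ih (i + 1)
    simp only [cfPoly, stieltjesTerm]
    refine ⟨fun hi hm => ?_, fun hi hm => ?_, fun hi hm => ?_, fun hi hm => ?_⟩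
    · obtain ⟨e1, e2⟩ := h2 (by grind) (by grind)
      rw [if_pos hi, ← e1, ← e2]
      simp
      ring
    · obtain ⟨e1, e2⟩ := h1 (by grind) (by grind)
      rw [if_neg (Nat.not_odd_iff_even.2 hi), ← e1, ← e2]
      simp
      ring
    · obtain ⟨e1, e2⟩ := h4 (by grind) (by grind)
      rw [if_pos hi, ← e1]
      simp [e2]
      ring
    · obtain ⟨e1, e2⟩ := h3 (by grind) (by grind)
      rw [if_neg (Nat.not_odd_iff_even.2 hi), ← e2]
      simp [e1]
      ring

theorem cfPolyS_fst_ne_zero {c : ℕ → ℝ} {i m : ℕ} (h : (cfPolyX c i m).1 ≠ 0) :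
    (cfPolyS c i m).1 ≠ 0 := by
  intro h0
  obtain ⟨h1, h2, h3, h4⟩ := comp_sq_cfPolyS c m i
  rw [h0] at h1 h2 h3 h4
  apply h
  rcases Nat.even_or_odd i with hi | hi <;> rcases Nat.even_or_odd m with hm | hm
  · simpa using (h4 hi hm).1.symm
  · simpa using (h2 hi hm).1.symm
  · simpa using (h1 hi hm).1.symm
  · simpa using (h3 hi hm).1.symm

theorem eval_stieltjesTerm (u : ℝ) (i : ℕ) :
    (stieltjesTerm i).eval u = if Odd i then u else 1 := by
  unfold stieltjesTerm
  split_ifs <;> simp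

theorem cfVal_succ_eq_div {c : ℕ → ℝ} {u : ℝ} {m i : ℕ}
    (h : cfVal c u (i + 1) m =
      (cfPolyS c (i + 1) (m + 1)).1.eval u / (cfPolyS c (i + 1) (m + 1)).2.eval u)
    (h0 : (cfPolyS c (i + 1) (m + 1)).1.eval u ≠ 0) :
    cfVal c u i (m + 1) =
      (cfPolyS c i (m + 1 + 1)).1.eval u / (cfPolyS c i (m + 1 + 1)).2.eval u := by
  have e1 : (cfPolyS c i (m + 1 + 1)).1 = C (c i) * stieltjesTerm i *
    (cfPolyS c (i + 1) (m + 1)).1 + (cfPolyS c (i + 1) (m + 1)).2 := rfl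
  have e2 : (cfPolyS c i (m + 1 + 1)).2 = (cfPolyS c (i + 1) (m + 1)).1 := rfl
  rw [cfVal, h, e1, e2, eval_add, eval_mul, eval_mul, eval_C, eval_stieltjesTerm]
  field_simp

theorem cfVal_eq_div (c : ℕ → ℝ) (u : ℝ) (m : ℕ) : ∀ i,
    (∀ j ≤ m, cfVal c u (i + j) (m - j) ≠ 0) →
      (cfPolyS c i (m + 1)).2.eval u ≠ 0 ∧
      cfVal c u i m = (cfPolyS c i (m + 1)).1.eval u / (cfPolyS c i (m + 1)).2.eval u := by
  induction m with
  | zero => intro i _; simp [cfPoly, cfVal, eval_stieltjesTerm]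
  | succ m ih =>
    intro i h
    obtain ⟨-, h2⟩ := ih (i + 1) fun j hj => by
      have := h (j + 1) (by omega)
      rwa [show i + (j + 1) = i + 1 + j by ring, show m + 1 - (j + 1) = m - j by omega] at this
    have h3 : cfVal c u (i + 1) m ≠ 0 := by simpa using h 1 (by omega)
    rw [h2] at h3
    have h4 := (div_ne_zero_iff.1 h3).1
    exact ⟨h4, cfVal_succ_eq_div h2 h4⟩

theorem cfVal_ne_zero (c : ℕ → ℝ) (u : ℝ) (m : ℕ) : ∀ i,
    (∀ j ≤ m, (cfPolyS c (i + j) (m + 1 - j)).1.eval u ≠ 0) →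
      cfVal c u i m ≠ 0 ∧
      cfVal c u i m = (cfPolyS c i (m + 1)).1.eval u / (cfPolyS c i (m + 1)).2.eval u := by
  induction m with
  | zero =>
    intro i h
    have h0 := h 0 le_rfl
    simp only [cfPoly, eval_add, eval_mul, eval_C, eval_stieltjesTerm] at h0
    simpa [cfPoly, cfVal, eval_stieltjesTerm] using h0
  | succ m ih =>
    intro i h
    have h4 : (cfPolyS c (i + 1) (m + 1)).1.eval u ≠ 0 := by simpa using h 1 (by omega)
    obtain ⟨-, h2⟩ := ih (i + 1) fun j hj => by
      have := h (j + 1) (by omega)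
      rwa [show i + (j + 1) = i + 1 + j by ring,
        show m + 1 + 1 - (j + 1) = m + 1 - j by omega] at this
    have h5 := cfVal_succ_eq_div h2 h4
    refine ⟨?_, h5⟩
    rw [h5]
    exact div_ne_zero (by simpa using h 0 (by omega)) h4

theorem selfInterlacingI_iff_mul_cfPolyX {n : ℕ} (hn : 1 ≤ n) {p A B : ℝ[X]}
    (hdeg : p.natDegree = n) (hAB : p = A + B)
    (hA : ∀ j, Odd (n + j) → A.coeff j = 0) (hB : ∀ j, Even (n + j) → B.coeff j = 0)
    (hrefl : ∀ x, (A - B).eval x = (-1) ^ n * p.eval (-x)) :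
    SelfInterlacingI p ↔ ∃ c : ℕ → ℝ, (∀ i, 1 ≤ i → i ≤ n → 0 < (-1 : ℝ) ^ i * c i) ∧
      B * (cfPolyX c 1 n).1 = A * (cfPolyX c 1 n).2 := by
  have hp0 : p ≠ 0 := by rintro rfl; simp at hdeg; omega
  have hhigh : ∀ j, n < j → A.coeff j = 0 ∧ B.coeff j = 0 := by
    intro j hj
    have h0 : p.coeff j = 0 := coeff_eq_zero_of_natDegree_lt (by omega)
    rw [hAB, coeff_add] at h0
    rcases Nat.even_or_odd (n + j) with h | h
    · have := hB j h
      exact ⟨by simpa [this] using h0, this⟩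
    · have := hA j h
      exact ⟨this, by simpa [this] using h0⟩
  have hBn : B.coeff n = 0 := hB n (by grind)
  have hAn : A.coeff n ≠ 0 := by
    have h0 : p.coeff n ≠ 0 := by
      rw [← hdeg]
      exact leadingCoeff_ne_zero.2 hp0
    rw [hAB, coeff_add, hBn, add_zero] at h0
    exact h0
  have hAdeg : A.degree = n := by
    refine le_antisymm ?_ (le_degree_of_ne_zero hAn)
    exact (degree_le_iff_coeff_zero _ _).2 fun j hj => (hhigh j (by exact_mod_cast hj)).1
  have hBdeg : B.degree < n := by
    rw [degree_lt_iff_coeff_zero]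
    intro j hj
    rcases hj.eq_or_lt with rfl | hj
    exacts [hBn, (hhigh j hj).2]
  constructor
  · intro h
    have hdef := definitePair_of_selfInterlacingI (by omega) hAB (by rwa [hdeg])
      (by rwa [hdeg]) h
    obtain ⟨c, k, -, hc, h1, h2⟩ := exists_cfPolyX_eq n 1 A B hAdeg hBdeg hA hB
      fun _ => by rwa [pow_one]
    refine ⟨c, fun i hi hi' => hc i hi (by omega), ?_⟩
    conv_lhs => rw [h2]
    conv_rhs => rw [h1]
    ring
  · rintro ⟨c, hc, h⟩
    have hdef := definitePair_cfPolyX c (n - 1) 1 fun j hj hj' => hc j hj (by omega)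
    rw [Nat.sub_add_cancel hn, pow_one] at hdef
    have hGdeg := (degree_cfPolyX c n 1 fun j hj hj' => right_ne_zero_of_mul
      (hc j hj (by omega)).ne').1
    have hcop := isCoprime_cfPoly (fun _ => X) c n 1
    obtain ⟨K, hK⟩ := hcop.dvd_of_dvd_mul_right (Dvd.intro_left B h)
    have hG0 : (cfPolyX c 1 n).1 ≠ 0 := hdef.ne_zero
    have hA0 : A ≠ 0 := by rintro rfl; simp at hAn
    have hKdeg : K.natDegree = 0 := by
      have h1 := natDegree_eq_of_degree_eq_some hGdeg
      have h2 := natDegree_eq_of_degree_eq_some hAdeg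
      rw [hK, natDegree_mul hG0 (by rintro rfl; exact hA0 (by rw [hK, mul_zero]))] at h2
      change (cfPolyX c 1 n).1.natDegree + K.natDegree = n at h2
      omega
    obtain ⟨k, rfl⟩ := natDegree_eq_zero.1 hKdeg
    have hk : k ≠ 0 := by rintro rfl; exact hA0 (by rw [hK, C_0, mul_zero])
    have hAk : A = C k * (cfPolyX c 1 n).1 := by rw [hK, mul_comm]
    have hBk : B = C k * (cfPolyX c 1 n).2 := by
      refine mul_right_cancel₀ hG0 ?_
      rw [h, hAk]
      ring
    refine selfInterlacingI_of_definitePair hAB (by rwa [hdeg]) ?_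
    have hk2 : 0 < k ^ 2 := by positivity
    convert hdef.linearComb (τ := -1) k 0 0 k (by linarith [sq k]) using 1
    · simpa using hAk
    · simpa using hBk

/-- Clearing denominators in the value of the Stieltjes continued fraction. -/
theorem forall_eval_div_eq_cfVal_iff {n : ℕ} (hn : 1 ≤ n) {c : ℕ → ℝ}
    (hc : ∀ i, 1 ≤ i → i ≤ n → c i ≠ 0) {N D : ℝ[X]} (hD : D ≠ 0) :
    (∀ u : ℝ, D.eval u ≠ 0 → (∀ i, 1 ≤ i → i ≤ n → cfVal c u i (n - i) ≠ 0) →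
      N.eval u / D.eval u = 1 / cfVal c u 1 (n - 1)) ↔
    N * (cfPolyS c 1 n).1 = D * (cfPolyS c 1 n).2 := by
  constructor
  · intro h
    set M := D * ∏ i ∈ Finset.Icc 1 n, (cfPolyS c i (n + 1 - i)).1 with hM
    have hM0 : M ≠ 0 := by
      refine mul_ne_zero hD (Finset.prod_ne_zero_iff.2 fun i hi => cfPolyS_fst_ne_zero ?_)
      rw [Finset.mem_Icc] at hi
      have := (degree_cfPolyX c (n + 1 - i) i fun j hj hj' => hc j (by omega) (by omega)).1
      intro h0
      rw [h0, degree_zero] at this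
      exact WithBot.bot_ne_coe this
    refine mul_left_cancel₀ hM0 (Polynomial.funext fun u => ?_)
    rw [eval_mul (p := M), eval_mul (p := M)]
    by_cases hu : M.eval u = 0
    · rw [hu, zero_mul, zero_mul]
    congr 1
    rw [hM, eval_mul, eval_prod, ← Ne, mul_ne_zero_iff, Finset.prod_ne_zero_iff] at hu
    obtain ⟨hDu, hFu⟩ := hu
    have key : ∀ i, 1 ≤ i → i ≤ n → cfVal c u i (n - i) ≠ 0 ∧ cfVal c u i (n - i) =
        (cfPolyS c i (n - i + 1)).1.eval u / (cfPolyS c i (n - i + 1)).2.eval u := by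
      intro i hi hi'
      refine cfVal_ne_zero c u (n - i) i fun j hj => ?_
      have := hFu (i + j) (Finset.mem_Icc.2 ⟨by omega, by omega⟩)
      rwa [show n + 1 - (i + j) = n - i + 1 - j by omega] at this
    have h1 := h u hDu fun i hi hi' => (key i hi hi').1
    obtain ⟨h2, h3⟩ := key 1 le_rfl hn
    rw [Nat.sub_add_cancel hn] at h3
    rw [h3] at h1 h2
    obtain ⟨h4, h5⟩ := div_ne_zero_iff.1 h2
    rw [eval_mul, eval_mul]
    field_simp at h1
    linarith
  · intro h u hDu hu
    obtain ⟨h1, h2⟩ := cfVal_eq_div c u (n - 1) 1 fun j hj => by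
      have := hu (1 + j) (by omega) (by omega)
      rwa [show n - (1 + j) = n - 1 - j by omega] at this
    have h3 := hu 1 le_rfl hn
    rw [Nat.sub_add_cancel hn] at h1 h2
    rw [h2] at h3
    have h4 := (div_ne_zero_iff.1 h3).1
    have h5 := congrArg (eval u) h
    rw [eval_mul, eval_mul] at h5
    rw [h2]
    field_simp
    linarith

theorem comp_X_sq_injective : Function.Injective fun q : ℝ[X] => q.comp (X ^ 2) := by
  intro q r h
  simp only [← expand_eq_comp_X_pow] at h
  exact expand_injective two_pos h

theorem coeff_comp_X_sq_of_odd (q : ℝ[X]) {j : ℕ} (hj : Odd j) :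
    (q.comp (X ^ 2)).coeff j = 0 := by
  rw [← expand_eq_comp_X_pow, coeff_expand two_pos, if_neg]
  grind

theorem coeff_X_mul_comp_X_sq_of_even (q : ℝ[X]) {j : ℕ} (hj : Even j) :
    (X * q.comp (X ^ 2)).coeff j = 0 := by
  cases j with
  | zero => exact coeff_X_mul_zero _
  | succ j => rw [coeff_X_mul, coeff_comp_X_sq_of_odd q (by grind)]

/-- Stieltjes continued fraction criterion: `p` of degree `n ≥ 1` with positive leading
coefficient and associated function `Φ` (equal to `po/pe` for even `n` and to
`pe/(X·po)` for odd `n`, where `p(z) = pe(z²) + z·po(z²)`) is self-interlacing of kind I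
iff there are reals `c_1, …, c_n` with `(-1)^i c_i > 0` such that
`Φ(u) = 1/(c_1 u + 1/(c_2 + 1/(c_3 u + ⋯ + 1/(c_n t_n(u))⋯)))` at every `u` where both
sides are defined. -/
theorem selfInterlacing_iff_stieltjes_cf
    (n : ℕ) (hn : 1 ≤ n) (p pe po : Polynomial ℝ)
    (hdeg : p.natDegree = n) (hlead : 0 < p.leadingCoeff)
    (hparts : p = pe.comp (Polynomial.X ^ 2) + Polynomial.X * po.comp (Polynomial.X ^ 2)) :
    SelfInterlacingI p ↔
      ∃ c : ℕ → ℝ,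
        (∀ i, 1 ≤ i → i ≤ n → 0 < (-1 : ℝ) ^ i * c i) ∧
        ∀ u : ℝ,
          Polynomial.eval u (if Even n then pe else Polynomial.X * po) ≠ 0 →
          (∀ i, 1 ≤ i → i ≤ n → cfVal c u i (n - i) ≠ 0) →
          Polynomial.eval u (if Even n then po else pe) /
              Polynomial.eval u (if Even n then pe else Polynomial.X * po) =
            1 / cfVal c u 1 (n - 1) := by
  have hp0 : p ≠ 0 := leadingCoeff_ne_zero.1 hlead.ne'
  set N := if Even n then po else pe with hN
  set D := if Even n then pe else X * po with hD
  obtain ⟨A, B, hAB, hA, hB, hrefl, hiff, hDA⟩ : ∃ A B : ℝ[X], p = A + B ∧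
      (∀ j, Odd (n + j) → A.coeff j = 0) ∧ (∀ j, Even (n + j) → B.coeff j = 0) ∧
      (∀ x, (A - B).eval x = (-1) ^ n * p.eval (-x)) ∧
      (∀ c, B * (cfPolyX c 1 n).1 = A * (cfPolyX c 1 n).2 ↔
        N * (cfPolyS c 1 n).1 = D * (cfPolyS c 1 n).2) ∧ (D = 0 → A = 0) := by
    rcases Nat.even_or_odd n with h | h
    · refine ⟨pe.comp (X ^ 2), X * po.comp (X ^ 2), hparts,
        fun j hj => coeff_comp_X_sq_of_odd _ (by grind),
        fun j hj => coeff_X_mul_comp_X_sq_of_even _ (by grind), fun x => ?_, fun c => ?_, ?_⟩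
      · rw [hparts, h.neg_one_pow]
        simp
        ring
      · obtain ⟨h1, h2⟩ := (comp_sq_cfPolyS c n 1).1 odd_one h
        rw [hN, hD, if_pos h, if_pos h, ← comp_X_sq_injective.eq_iff (a := po * _), ← h1,
          ← h2]
        simp only [mul_comp]
        rw [mul_assoc, mul_left_comm (pe.comp _), mul_right_inj' X_ne_zero]
      · rw [hD, if_pos h]
        rintro rfl
        simp
    · have h' := Nat.not_even_iff_odd.2 h
      refine ⟨X * po.comp (X ^ 2), pe.comp (X ^ 2), by rw [hparts, add_comm],
        fun j hj => coeff_X_mul_comp_X_sq_of_even _ (by grind),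
        fun j hj => coeff_comp_X_sq_of_odd _ (by grind), fun x => ?_, fun c => ?_, ?_⟩
      · rw [hparts, h.neg_one_pow]
        simp
        ring
      · obtain ⟨h1, h2⟩ := (comp_sq_cfPolyS c n 1).2.2.1 odd_one h
        rw [hN, hD, if_neg h', if_neg h', ← comp_X_sq_injective.eq_iff (a := pe * _)]
        simp only [mul_comp, h1, h2, X_comp]
        rw [mul_left_comm (pe.comp _), sq, mul_assoc X X, mul_assoc X (X * _),
          mul_right_inj' X_ne_zero]
      · rw [hD, if_neg h', mul_eq_zero, or_iff_right X_ne_zero]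
        rintro rfl
        simp
  have hA0 : A ≠ 0 := by
    intro h0
    have h1 := leadingCoeff_ne_zero.2 hp0
    rw [leadingCoeff, hdeg, hAB, h0, zero_add, hB n (by grind)] at h1
    exact h1 rfl
  rw [selfInterlacingI_iff_mul_cfPolyX hn hdeg hAB hA hB hrefl]
  refine exists_congr fun c => and_congr_right fun hc => ?_
  rw [hiff, forall_eval_div_eq_cfVal_iff hn
    (fun i hi hi' => right_ne_zero_of_mul (hc i hi hi').ne') fun h0 => hA0 (hDA h0)]
end

section
/- Let p be a real polynomial of degree n ≥ 2 with positive leading coefficient that is self-interlacing of kind I, and write p(z) = p_e(z²) + z·p_o(z²) with real polynomials p_e, p_o. Then for every j with 1 ≤ j ≤ ⌊n/2⌋ − 1, the polynomial p_j(z) = p_e^{(j)}(z²) + z·p_o^{(j)}(z²), built from the j-th derivatives of p_e and p_o, is again self-interlacing of kind I. -/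
open Polynomial

lemma eq_C_coeff_mul_nodal {s : Finset ℕ} {v : ℕ → ℝ} (hv : Set.InjOn v s) {f : ℝ[X]}
    (hdeg : f.natDegree ≤ s.card) (hroot : ∀ i ∈ s, f.eval (v i) = 0) :
    f = C (f.coeff s.card) * Lagrange.nodal s v := by
  refine eq_of_degree_sub_lt_of_eval_index_eq s hv ?_ fun i hi => ?_
  · rw [degree_lt_iff_coeff_zero]
    intro m hm
    have hn : (Lagrange.nodal s v).natDegree = s.card := Lagrange.natDegree_nodal
    rcases hm.eq_or_lt with rfl | hm
    · have h1 : (Lagrange.nodal s v).coeff s.card = 1 := by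
        rw [← hn]; exact Lagrange.nodal_monic
      simp [h1]
    · simp [coeff_eq_zero_of_natDegree_lt (hdeg.trans_lt hm),
        coeff_eq_zero_of_natDegree_lt (hn.trans_lt hm)]
  · simp [hroot i hi, Lagrange.eval_nodal_at_node hi]

lemma exists_root_of_eval_mul_eval_neg (p : ℝ[X]) {a b : ℝ} (hab : a < b)
    (h : p.eval a * p.eval b < 0) : ∃ c, a < c ∧ c < b ∧ p.eval c = 0 := by
  rcases mul_neg_iff.1 h with ⟨ha, hb⟩ | ⟨ha, hb⟩
  · obtain ⟨c, hc, h0⟩ := intermediate_value_Ioo' hab.le p.continuous.continuousOn ⟨hb, ha⟩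
    exact ⟨c, hc.1, hc.2, h0⟩
  · obtain ⟨c, hc, h0⟩ := intermediate_value_Ioo hab.le p.continuous.continuousOn ⟨ha, hb⟩
    exact ⟨c, hc.1, hc.2, h0⟩

lemma exists_gt_leadingCoeff_mul_eval_pos {p : ℝ[X]} (hp : p ≠ 0) (B : ℝ) :
    ∃ M, B < M ∧ 0 < p.leadingCoeff * p.eval M := by
  have hl : p.leadingCoeff ≠ 0 := leadingCoeff_ne_zero.2 hp
  rcases Nat.eq_zero_or_pos p.natDegree with h0 | hpos
  · refine ⟨B + 1, by linarith, ?_⟩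
    rw [eq_C_of_natDegree_eq_zero h0] at hl ⊢
    simp only [leadingCoeff_C, eval_C] at hl ⊢
    exact mul_self_pos.2 hl
  · have ht := tendsto_atTop_of_leadingCoeff_nonneg (C p.leadingCoeff * p)
      (by rw [degree_C_mul hl]; exact natDegree_pos_iff_degree_pos.1 hpos)
      (by simp only [leadingCoeff_mul, leadingCoeff_C]; exact mul_self_nonneg _)
    obtain ⟨M, h1, h2⟩ :=
      ((ht.eventually_gt_atTop 0).and (Filter.eventually_gt_atTop B)).exists
    exact ⟨M, h2, by simpa using h1⟩

lemma eval_derivative_nodal_ne_zero {s : Finset ℕ} {v : ℕ → ℝ} (hv : Set.InjOn v s) {k : ℕ}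
    (hk : k ∈ s) : (derivative (Lagrange.nodal s v)).eval (v k) ≠ 0 := by
  rw [Lagrange.eval_nodal_derivative_eval_node_eq hk, Lagrange.eval_nodal]
  refine Finset.prod_ne_zero_iff.2 fun i hi => sub_ne_zero.2 fun h => ?_
  rw [Finset.mem_erase] at hi
  exact hi.1 (hv hi.2 hk h.symm)

lemma nodal_wronskian_neg {s : Finset ℕ} (hs : s.Nonempty) {v : ℕ → ℝ} (hv : Set.InjOn v s)
    {g : ℝ[X]} (hdeg : g.natDegree ≤ s.card)
    (hpos : ∀ k ∈ s, 0 < g.eval (v k) * (derivative (Lagrange.nodal s v)).eval (v k)) (u : ℝ) :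
    (Lagrange.nodal s v).eval u * (derivative g).eval u
      - (derivative (Lagrange.nodal s v)).eval u * g.eval u < 0 := by
  set N := Lagrange.nodal s v with hN
  set m : ℕ → ℝ := fun k => g.eval (v k) / (derivative N).eval (v k) with hm
  have hmpos : ∀ k ∈ s, 0 < m k := fun k hk => by
    rcases mul_pos_iff.1 (hpos k hk) with h | h
    · exact div_pos h.1 h.2
    · exact div_pos_of_neg_of_neg h.1 h.2
  have hcoeff : N.coeff s.card = 1 := by
    have hn : N.natDegree = s.card := Lagrange.natDegree_nodal
    rw [← hn]; exact Lagrange.nodal_monic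
  have hg : g = C (g.coeff s.card) * N
      + ∑ k ∈ s, C (m k) * Lagrange.nodal (s.erase k) v := by
    refine eq_of_degree_sub_lt_of_eval_index_eq s hv ?_ fun i hi => ?_
    · rw [degree_lt_iff_coeff_zero]
      intro j hj
      have hsum : (∑ k ∈ s, C (m k) * Lagrange.nodal (s.erase k) v).coeff j = 0 := by
        rw [finsetSum_coeff]
        refine Finset.sum_eq_zero fun k hk => ?_
        rw [coeff_C_mul, coeff_eq_zero_of_natDegree_lt, mul_zero]
        rw [Lagrange.natDegree_nodal]
        exact (Finset.card_erase_lt_of_mem hk).trans_le hj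
      rcases hj.eq_or_lt with rfl | hj
      · simp [hsum, hcoeff]
      · have hn : N.natDegree = s.card := Lagrange.natDegree_nodal
        rw [coeff_sub, coeff_add, hsum, coeff_C_mul,
          coeff_eq_zero_of_natDegree_lt (hdeg.trans_lt hj),
          coeff_eq_zero_of_natDegree_lt (hn.trans_lt hj)]
        simp
    · rw [eval_add, eval_mul, hN, Lagrange.eval_nodal_at_node hi, mul_zero, zero_add,
        eval_finsetSum, Finset.sum_eq_single_of_mem i hi]
      · rw [eval_mul, eval_C, ← Lagrange.eval_nodal_derivative_eval_node_eq hi, hm]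
        exact (div_mul_cancel₀ _ (eval_derivative_nodal_ne_zero hv hi)).symm
      · intro k _ hki
        rw [eval_mul, Lagrange.eval_nodal_at_node (Finset.mem_erase.2 ⟨hki.symm, hi⟩), mul_zero]
  have hkey : N.eval u * (derivative g).eval u - (derivative N).eval u * g.eval u
      = -∑ k ∈ s, m k * (Lagrange.nodal (s.erase k) v).eval u ^ 2 := by
    have h1 : ∀ k ∈ s, m k * (Lagrange.nodal (s.erase k) v).eval u ^ 2
        = (derivative N).eval u * (m k * (Lagrange.nodal (s.erase k) v).eval u)
          - N.eval u * (m k * (derivative (Lagrange.nodal (s.erase k) v)).eval u) := by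
      intro k hk
      have h2 : N = (X - C (v k)) * Lagrange.nodal (s.erase k) v :=
        Lagrange.nodal_eq_mul_nodal_erase hk
      rw [h2]
      simp only [derivative_mul, derivative_sub, derivative_X, derivative_C, eval_mul, eval_add,
        eval_sub, eval_X, eval_C, sub_zero, eval_one]
      ring
    rw [Finset.sum_congr rfl h1, Finset.sum_sub_distrib, ← Finset.mul_sum, ← Finset.mul_sum]
    conv_lhs => rw [hg]
    simp only [derivative_add, derivative_mul, derivative_C, eval_mul, eval_add, eval_C, zero_mul,
      zero_add, eval_finsetSum, derivative_sum]
    ring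
  rw [hkey, neg_lt_zero]
  refine Finset.sum_pos' (fun k hk => mul_nonneg (hmpos k hk).le (sq_nonneg _)) ?_
  have hex : ∃ k ∈ s, ∀ i ∈ s.erase k, u ≠ v i := by
    by_cases h : ∃ k ∈ s, u = v k
    · obtain ⟨k, hk, rfl⟩ := h
      refine ⟨k, hk, fun i hi h => ?_⟩
      rw [Finset.mem_erase] at hi
      exact hi.1 (hv hi.2 hk h.symm)
    · push Not at h
      exact ⟨_, hs.choose_spec, fun i hi => h i (Finset.mem_of_mem_erase hi)⟩
  obtain ⟨k, hk, hne⟩ := hex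
  refine ⟨k, hk, mul_pos (hmpos k hk) (sq_pos_of_ne_zero ?_)⟩
  exact Lagrange.eval_nodal_not_at_node hne

/-- The polynomial `f` has leading coefficient `a` and exactly the `l` simple positive roots
`e 0 < e 1 < ⋯`. -/
structure PositiveSimpleRoots (l : ℕ) (f : ℝ[X]) (e : ℕ → ℝ) (a : ℝ) : Prop where
  ne_zero : a ≠ 0
  mono : StrictMonoOn e (Finset.range l)
  pos : ∀ k < l, 0 < e k
  eq_nodal : f = C a * Lagrange.nodal (Finset.range l) e

namespace PositiveSimpleRoots

variable {l : ℕ} {f : ℝ[X]} {e : ℕ → ℝ} {a : ℝ}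

lemma eval_mul_sub_pos (h : PositiveSimpleRoots l f e a) {k : ℕ} (hk : k < l) {u : ℝ}
    (hlo : ∀ i < k, e i < u) (hhi : ∀ i, k < i → i < l → u < e i) :
    0 < f.eval u * (derivative f).eval (e k) * (u - e k) ∨ u = e k := by
  rw [or_iff_not_imp_right]
  intro hu
  have hk' : k ∈ Finset.range (l) := Finset.mem_range.2 hk
  have h1 : f.eval u * (derivative f).eval (e k) * (u - e k)
      = (a * (u - e k)) ^ 2 * ∏ i ∈ (Finset.range (l)).erase k, ((u - e i) * (e k - e i)) := by
    rw [h.eq_nodal, derivative_C_mul, eval_C_mul, eval_C_mul,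
      Lagrange.eval_nodal_derivative_eval_node_eq hk', Lagrange.eval_nodal, Lagrange.eval_nodal,
      ← Finset.mul_prod_erase _ _ hk', Finset.prod_mul_distrib]
    ring
  rw [h1]
  refine mul_pos (sq_pos_of_ne_zero (mul_ne_zero h.ne_zero (sub_ne_zero.2 hu)))
    (Finset.prod_pos fun i hi => ?_)
  rw [Finset.mem_erase] at hi
  have hi' : i < l := Finset.mem_range.1 hi.2
  rcases hi.1.lt_or_gt with hik | hik
  · exact mul_pos (sub_pos.2 (hlo i hik)) (sub_pos.2 (h.mono hi.2 hk' hik))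
  · exact mul_pos_of_neg_of_neg (sub_neg.2 (hhi i hik hi')) (sub_neg.2 (h.mono hk' hi.2 hik))

lemma eval_mul_pos (h : PositiveSimpleRoots l f e a) {k : ℕ} (hk : k < l) {u : ℝ}
    (hlo : e k < u) (hhi : k + 1 < l → u < e (k + 1)) :
    0 < f.eval u * (derivative f).eval (e k) := by
  have hlo' : ∀ i < k, e i < u := fun i hi =>
    (h.mono (by simp; omega) (by simpa) hi).trans hlo
  have hhi' : ∀ i, k < i → i < l → u < e i := fun i hi hin =>
    (hhi (by omega)).trans_le (h.mono.monotoneOn (by simp; omega) (by simpa) (by omega))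
  rcases h.eval_mul_sub_pos hk hlo' hhi' with h1 | h1
  · exact pos_of_mul_pos_left h1 (sub_pos.2 hlo).le
  · exact absurd h1 hlo.ne'

lemma eval_mul_neg (h : PositiveSimpleRoots l f e a) {k : ℕ} (hk : k < l) {u : ℝ}
    (hlo : ∀ i, i + 1 = k → e i < u) (hhi : u < e k) :
    f.eval u * (derivative f).eval (e k) < 0 := by
  have hlo' : ∀ i < k, e i < u := fun i hi =>
    (h.mono.monotoneOn (by simp; omega) (by simp; omega) (by omega)).trans_lt
      (hlo (k - 1) (by omega))
  have hhi' : ∀ i, k < i → i < l → u < e i := fun i hi hin =>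
    hhi.trans (h.mono (by simpa) (by simpa) hi)
  rcases h.eval_mul_sub_pos hk hlo' hhi' with h1 | h1
  · exact neg_of_mul_pos_left h1 (sub_neg.2 hhi).le
  · exact absurd h1 hhi.ne

lemma eval_eq_zero (h : PositiveSimpleRoots l f e a) {k : ℕ} (hk : k < l) :
    f.eval (e k) = 0 := by
  rw [h.eq_nodal, eval_C_mul, Lagrange.eval_nodal_at_node (by simpa), mul_zero]

lemma natDegree_eq (h : PositiveSimpleRoots l f e a) : f.natDegree = l := by
  rw [h.eq_nodal, natDegree_C_mul h.ne_zero, Lagrange.natDegree_nodal, Finset.card_range]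

lemma leadingCoeff_eq (h : PositiveSimpleRoots l f e a) : f.leadingCoeff = a := by
  rw [h.eq_nodal, leadingCoeff_mul, leadingCoeff_C, Lagrange.nodal_monic.leadingCoeff, mul_one]

end PositiveSimpleRoots

/-- The polynomial `f` has `n / 2` simple positive roots `e 0 < e 1 < ⋯`, and `g` interlaces it
in the way that the odd part of a degree `n` polynomial interlaces its even part if the roots of
that polynomial have distinct absolute values and, ordered by them, alternate in sign starting
with a positive one. -/
structure InterlacingParts (n : ℕ) (f g : ℝ[X]) (e : ℕ → ℝ) (a : ℝ) : Prop
    extends PositiveSimpleRoots (n / 2) f e a where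
  sign : ∀ k < n / 2, 0 < g.eval (e k) * (derivative f).eval (e k)
  natDegree_le : g.natDegree ≤ n / 2
  coeff_even : Even n → g.coeff (n / 2) = 0
  coeff_odd : Odd n → a * g.coeff (n / 2) < 0

namespace InterlacingParts

variable {n : ℕ} {f g : ℝ[X]} {e : ℕ → ℝ} {a : ℝ}

lemma wronskian_neg (h : InterlacingParts n f g e a) (hn : 0 < n / 2) {q : ℝ[X]}
    (hdeg : q.natDegree ≤ n / 2)
    (hpos : ∀ k < n / 2, 0 < q.eval (e k) * (derivative f).eval (e k)) (u : ℝ) :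
    f.eval u * (derivative q).eval u - (derivative f).eval u * q.eval u < 0 := by
  have hw := nodal_wronskian_neg (s := Finset.range (n / 2)) (by simp; omega) h.mono.injOn
    (g := C a * q) ((natDegree_C_mul_le _ _).trans (by simpa)) (fun k hk => ?_) u
  · rw [h.eq_nodal]
    simp only [derivative_C_mul, eval_C_mul] at hw ⊢
    linarith
  · have := hpos k (Finset.mem_range.1 hk)
    rw [h.eq_nodal] at this
    simp only [derivative_C_mul, eval_C_mul] at this ⊢
    linarith

lemma eval_derivative_ne_zero (h : InterlacingParts n f g e a) {k : ℕ} (hk : k < n / 2) :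
    (derivative f).eval (e k) ≠ 0 :=
  right_ne_zero_of_mul (h.sign k hk).ne'

lemma derivative_parts (h : InterlacingParts (n + 2) f g e a) :
    ∃ e' a', InterlacingParts n (derivative f) (derivative g) e' a' := by
  have hl : (n + 2) / 2 = n / 2 + 1 := by omega
  have hroot : ∀ k, ∃ c, k < n / 2 → e k < c ∧ c < e (k + 1) ∧ (derivative f).eval c = 0 := by
    intro k
    by_cases hk : k < n / 2
    · obtain ⟨c, hc, h0⟩ := exists_deriv_eq_zero (f := fun x => f.eval x)
        (h.mono (show k ∈ _ by simp; omega) (show k + 1 ∈ _ by simp; omega) (by omega))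
        f.continuous.continuousOn
        (by rw [h.eval_eq_zero (by omega), h.eval_eq_zero (by omega)])
      exact ⟨c, fun _ => ⟨hc.1, hc.2, by simpa using h0⟩⟩
    · exact ⟨0, fun hk' => absurd hk' hk⟩
  choose c hc using hroot
  have hmono : StrictMonoOn c (Finset.range (n / 2)) := by
    intro i hi j hj hij
    simp only [Finset.coe_range, Set.mem_Iio] at hi hj
    exact (hc i hi).2.1.trans_le ((h.mono.monotoneOn (by simp; omega) (by simp; omega)
      (by omega)).trans (hc j hj).1.le)
  have hcoeff : (derivative f).coeff (n / 2) = a * ((n / 2 : ℕ) + 1) := by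
    rw [coeff_derivative, ← h.leadingCoeff_eq, leadingCoeff, h.natDegree_eq, hl]
  have hp : (0 : ℝ) < (n / 2 : ℕ) + 1 := by positivity
  have hdf : (derivative f).natDegree ≤ n / 2 := by
    have := natDegree_derivative_le f
    rw [h.natDegree_eq] at this
    omega
  refine ⟨c, a * ((n / 2 : ℕ) + 1), ⟨⟨mul_ne_zero h.ne_zero hp.ne', hmono, fun k hk => ?_, ?_⟩,
    fun k hk => ?_, ?_, fun hn => ?_, fun hn => ?_⟩⟩
  · exact (h.pos k (by omega)).trans (hc k hk).1
  · have := eq_C_coeff_mul_nodal (s := Finset.range (n / 2)) hmono.injOn (f := derivative f)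
      (by rwa [Finset.card_range]) (fun i hi => (hc i (Finset.mem_range.1 hi)).2.2)
    rwa [Finset.card_range, hcoeff] at this
  · have h1 := h.wronskian_neg (by omega) h.natDegree_le h.sign (c k)
    have h2 := h.wronskian_neg (by omega) (q := derivative f) (hdf.trans (by omega))
      (fun i hi => mul_self_pos.2 (h.eval_derivative_ne_zero hi)) (c k)
    rw [(hc k hk).2.2, zero_mul, sub_zero] at h1 h2
    refine pos_of_mul_pos_right (a := f.eval (c k) ^ 2) ?_ (sq_nonneg _)
    linarith [mul_pos_of_neg_of_neg h1 h2]
  · have := natDegree_derivative_le g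
    have := h.natDegree_le
    omega
  · rw [coeff_derivative, ← hl, h.coeff_even (by simpa [parity_simps] using hn), zero_mul]
  · have := h.coeff_odd (by simpa [parity_simps] using hn)
    rw [coeff_derivative, ← hl]
    have h3 := mul_neg_of_neg_of_pos this (mul_pos hp hp)
    linarith

lemma iterate_derivative (j : ℕ) (h : InterlacingParts (n + 2 * j) f g e a) :
    ∃ e' a', InterlacingParts n (derivative^[j] f) (derivative^[j] g) e' a' := by
  induction j generalizing f g e a with
  | zero => exact ⟨e, a, h⟩
  | succ j ih =>
    obtain ⟨e', a', h'⟩ := derivative_parts (n := n + 2 * j) h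
    exact ih h'

end InterlacingParts

lemma coeff_two_mul_of_parts (f g : ℝ[X]) (k : ℕ) :
    (f.comp (X ^ 2) + X * g.comp (X ^ 2)).coeff (2 * k) = f.coeff k := by
  rw [← expand_eq_comp_X_pow, ← expand_eq_comp_X_pow, coeff_add, mul_comm 2 k,
    coeff_expand_mul two_pos]
  cases k with
  | zero => simp
  | succ k =>
    rw [show (k + 1) * 2 = (2 * k + 1) + 1 by ring, coeff_X_mul, coeff_expand two_pos,
      if_neg (by omega), add_zero]

lemma coeff_two_mul_add_one_of_parts (f g : ℝ[X]) (k : ℕ) :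
    (f.comp (X ^ 2) + X * g.comp (X ^ 2)).coeff (2 * k + 1) = g.coeff k := by
  rw [← expand_eq_comp_X_pow, ← expand_eq_comp_X_pow, coeff_add, coeff_X_mul, mul_comm 2 k,
    coeff_expand_mul two_pos, coeff_expand two_pos, if_neg (by omega), zero_add]

lemma eval_of_parts (f g : ℝ[X]) (x : ℝ) :
    (f.comp (X ^ 2) + X * g.comp (X ^ 2)).eval x = f.eval (x ^ 2) + x * g.eval (x ^ 2) := by
  simp

/-- The polynomial `q` has exactly `n` roots, all of them real and simple; their absolute values
`m 0 < m 1 < ⋯` are distinct and positive, and ordered by them the roots alternate in sign,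
starting with a positive one. -/
def AlternatingRoots (n : ℕ) (q : ℝ[X]) : Prop :=
  ∃ (m : ℕ → ℝ) (b : ℝ), b ≠ 0 ∧ StrictMonoOn m (Finset.range n) ∧ (∀ i < n, 0 < m i) ∧
    q = C b * Lagrange.nodal (Finset.range n) (fun i => (-1) ^ i * m i)

lemma AlternatingRoots.of_intervals {n : ℕ} {q : ℝ[X]} (hdeg : q.natDegree = n) (hq : q ≠ 0)
    {t m : ℕ → ℝ} (ht : 0 ≤ t 0) (hlo : ∀ i < n, t i < m i)
    (hhi : ∀ i, i + 1 < n → m i < t (i + 1))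
    (hroot : ∀ i < n, q.eval ((-1) ^ i * m i) = 0) : AlternatingRoots n q := by
  have hstep : ∀ i j, i < j → j < n → m i < m j := by
    intro i j hij
    induction j, hij using Nat.le_induction with
    | base => exact fun hn => (hhi i hn).trans (hlo _ hn)
    | succ j hj ih =>
      exact fun hn => (ih (by omega)).trans ((hhi j hn).trans (hlo _ hn))
  have hmono : StrictMonoOn m (Finset.range n) := fun i _ j hj hij =>
    hstep i j hij (by simpa using hj)
  have hpos : ∀ i < n, 0 < m i := fun i hi => by
    have h0 := ht.trans_lt (hlo 0 (by omega))
    rcases Nat.eq_zero_or_pos i with rfl | h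
    · exact h0
    · exact h0.trans (hstep 0 i h hi)
  refine ⟨m, q.coeff n, ?_, hmono, hpos, ?_⟩
  · rw [← hdeg]; exact leadingCoeff_ne_zero.2 hq
  · have := eq_C_coeff_mul_nodal (s := Finset.range n) (v := fun i => (-1) ^ i * m i) (f := q)
      ?_ (by simp [hdeg]) (fun i hi => hroot i (Finset.mem_range.1 hi))
    · rwa [Finset.card_range] at this
    · intro i hi j hj hij
      have := congrArg abs hij
      simp only [abs_mul, abs_pow, abs_neg, abs_one, one_pow, one_mul] at this
      rw [abs_of_pos (hpos i (by simpa using hi)), abs_of_pos (hpos j (by simpa using hj))] at this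
      exact hmono.injOn hi hj this

namespace InterlacingParts

variable {n : ℕ} {f g : ℝ[X]} {e : ℕ → ℝ} {a : ℝ}

lemma coeff_ne_zero (h : InterlacingParts n f g e a) :
    (f.comp (X ^ 2) + X * g.comp (X ^ 2)).coeff n ≠ 0 := by
  rcases Nat.even_or_odd' n with ⟨k, rfl | rfl⟩
  · rw [coeff_two_mul_of_parts, show k = 2 * k / 2 by omega, ← h.natDegree_eq,
      coeff_natDegree, h.leadingCoeff_eq]
    exact h.ne_zero
  · rw [coeff_two_mul_add_one_of_parts]
    have := h.coeff_odd (odd_two_mul_add_one k)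
    rw [show (2 * k + 1) / 2 = k by omega] at this
    exact right_ne_zero_of_mul this.ne

lemma natDegree_parts (h : InterlacingParts n f g e a) :
    (f.comp (X ^ 2) + X * g.comp (X ^ 2)).natDegree = n := by
  refine natDegree_eq_of_le_of_coeff_ne_zero ?_ h.coeff_ne_zero
  rw [natDegree_le_iff_coeff_eq_zero]
  intro N hN
  have h1 := h.natDegree_le
  have h2 := h.natDegree_eq
  rcases Nat.even_or_odd' N with ⟨k, rfl | rfl⟩
  · rw [coeff_two_mul_of_parts]
    exact coeff_eq_zero_of_natDegree_lt (by omega)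
  · rw [coeff_two_mul_add_one_of_parts]
    rcases (show n / 2 ≤ k by omega).eq_or_lt with hk | hk
    · rw [← hk]
      exact h.coeff_even (by rw [Nat.even_iff]; omega)
    · exact coeff_eq_zero_of_natDegree_lt (by omega)

lemma lead_mul_eval_derivative_pos (h : InterlacingParts n f g e a) {k : ℕ}
    (hk : k + 1 = n / 2) : 0 < a * (derivative f).eval (e k) := by
  obtain ⟨M, hM, h1⟩ := exists_gt_leadingCoeff_mul_eval_pos (p := f)
    (leadingCoeff_ne_zero.1 (h.leadingCoeff_eq ▸ h.ne_zero)) (e k)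
  rw [h.leadingCoeff_eq] at h1
  have h2 := h.eval_mul_pos (by omega) hM (by omega)
  refine pos_of_mul_pos_right (a := f.eval M ^ 2) ?_ (sq_nonneg _)
  linarith [mul_pos h1 h2]

lemma eval_mul_eval_pos (h : InterlacingParts n f g e a) {k : ℕ} (hk : k < n / 2) {c : ℝ}
    (hc : 0 < c * (derivative f).eval (e k)) : 0 < c * g.eval (e k) := by
  refine pos_of_mul_pos_right (a := (derivative f).eval (e k) ^ 2) ?_ (sq_nonneg _)
  linarith [mul_pos hc (h.sign k hk)]

lemma exists_root_between (h : InterlacingParts n f g e a) (k : ℕ)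
    (hk : 2 * k + 2 < n) :
    ∃ o, e k < o ∧ (k + 1 < n / 2 → o < e (k + 1)) ∧ g.eval o = 0 := by
  by_cases hk1 : k + 1 < n / 2
  · have hlt : e k < e (k + 1) :=
      h.mono (by simp; omega) (by simp; omega) (by omega)
    obtain ⟨u, hu1, hu2⟩ := exists_between hlt
    have h1 := h.eval_mul_eval_pos (by omega)
      (h.eval_mul_pos (k := k) (by omega) hu1 (fun _ => hu2))
    have h2 := h.eval_mul_neg (k := k + 1) hk1 (u := u)
      (fun i hi => by obtain rfl : i = k := by omega
                      exact hu1) hu2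
    have h3 := h.eval_mul_eval_pos hk1 (c := -f.eval u) (by linarith)
    obtain ⟨o, ho1, ho2, ho⟩ := exists_root_of_eval_mul_eval_neg g hlt (by
      have := mul_pos h1 h3
      have h4 : 0 < f.eval u ^ 2 * -(g.eval (e k) * g.eval (e (k + 1))) := by linarith
      linarith [pos_of_mul_pos_right h4 (sq_nonneg _)])
    exact ⟨o, ho1, fun _ => ho2, ho⟩
  · have hodd : Odd n := by rw [Nat.odd_iff]; omega
    have hneg := h.coeff_odd hodd
    have hg : g.leadingCoeff = g.coeff (n / 2) := by
      rw [leadingCoeff, natDegree_eq_of_le_of_coeff_ne_zero h.natDegree_le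
        (right_ne_zero_of_mul hneg.ne)]
    obtain ⟨M, hM, h1⟩ := exists_gt_leadingCoeff_mul_eval_pos (p := g)
      (by rintro rfl; simp at hneg) (e k)
    rw [hg] at h1
    have h2 := h.eval_mul_eval_pos (by omega) (h.lead_mul_eval_derivative_pos (k := k) (by omega))
    obtain ⟨o, ho1, -, ho⟩ := exists_root_of_eval_mul_eval_neg g hM (by
      have h3 := mul_pos (mul_pos h1 h2) (neg_pos.2 hneg)
      have h4 : 0 < (a * g.coeff (n / 2)) ^ 2 * -(g.eval (e k) * g.eval M) := by linarith
      linarith [pos_of_mul_pos_right h4 (sq_nonneg _)])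
    exact ⟨o, ho1, fun hk => absurd hk hk1, ho⟩

lemma alternatingRoots (h : InterlacingParts n f g e a) (hn : 2 ≤ n) :
    AlternatingRoots n (f.comp (X ^ 2) + X * g.comp (X ^ 2)) := by
  set q := f.comp (X ^ 2) + X * g.comp (X ^ 2) with hq
  have hqe : ∀ x, q.eval x = f.eval (x ^ 2) + x * g.eval (x ^ 2) := eval_of_parts f g
  have hq0 : q ≠ 0 := fun h0 => h.coeff_ne_zero (by rw [← hq, h0, coeff_zero])
  have hqn : q.natDegree = n := h.natDegree_parts
  have hexo : ∀ k, ∃ o, (k = 0 → o = 0) ∧ (∀ i, i + 1 = k → 2 * k < n →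
      e i < o ∧ (k < n / 2 → o < e k) ∧ g.eval o = 0) := by
    intro k
    rcases k with _ | k
    · exact ⟨0, fun _ => rfl, fun i hi => by omega⟩
    · by_cases hk : 2 * k + 2 < n
      · obtain ⟨o, ho⟩ := h.exists_root_between k hk
        refine ⟨o, by omega, fun i hi _ => ?_⟩
        obtain rfl : i = k := by omega
        exact ho
      · exact ⟨0, by omega, by omega⟩
  choose o ho0 ho using hexo
  have honn : ∀ k, 2 * k < n → 0 ≤ o k := by
    intro k hk
    rcases k with _ | k
    · rw [ho0 0 rfl]
    · exact (h.pos k (by omega)).le.trans (ho (k + 1) k rfl hk).1.le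
  have hoe : ∀ k < n / 2, o k < e k := by
    intro k hk
    rcases k with _ | k
    · rw [ho0 0 rfl]; exact h.pos 0 hk
    · exact (ho (k + 1) k rfl (by omega)).2.1 hk
  have hqo : ∀ k, 2 * k < n → q.eval √(o k) = f.eval (o k) ∧ q.eval (-√(o k)) = f.eval (o k) := by
    intro k hk
    rw [hqe, hqe, neg_sq, Real.sq_sqrt (honn k hk)]
    rcases k with _ | k
    · simp [ho0 0 rfl]
    · simp [(ho (k + 1) k rfl hk).2.2]
  have hqee : ∀ k < n / 2, q.eval √(e k) = √(e k) * g.eval (e k) ∧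
      q.eval (-√(e k)) = -(√(e k) * g.eval (e k)) := by
    intro k hk
    rw [hqe, hqe, neg_sq, Real.sq_sqrt (h.pos k hk).le, h.eval_eq_zero hk]
    constructor <;> ring
  have hsqrt : ∀ k < n / 2, 0 < √(e k) := fun k hk => Real.sqrt_pos.2 (h.pos k hk)
  set t : ℕ → ℝ := fun i => if Even i then √(o (i / 2)) else √(e (i / 2)) with ht
  have hte : ∀ k, t (2 * k) = √(o k) := fun k => by simp [ht]
  have hto : ∀ k, t (2 * k + 1) = √(e k) := fun k => by
    have : (2 * k + 1) / 2 = k := by omega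
    simp [ht, this]
  have hex : ∀ i, ∃ c, i < n → t i < c ∧ (i + 1 < n → c < t (i + 1)) ∧
      q.eval ((-1) ^ i * c) = 0 := by
    intro i
    by_cases hi : i < n
    swap
    · exact ⟨0, fun h => absurd h hi⟩
    rcases Nat.even_or_odd' i with ⟨k, rfl | rfl⟩
    · simp only [pow_mul, neg_one_sq, one_pow, one_mul, hto, hte]
      by_cases hk : k < n / 2
      · have h1 := h.eval_mul_neg hk (u := o k)
          (fun i hi' => (ho k i hi' hi).1) (hoe k hk)
        have h2 := h.eval_mul_eval_pos hk (c := -f.eval (o k)) (by linarith)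
        obtain ⟨c, hc1, hc2, hc⟩ := exists_root_of_eval_mul_eval_neg q
          (Real.sqrt_lt_sqrt (honn k hi) (hoe k hk)) (by
            rw [(hqo k hi).1, (hqee k hk).1]
            linarith [mul_pos h2 (hsqrt k hk)])
        exact ⟨c, fun _ => ⟨hc1, fun _ => hc2, hc⟩⟩
      · obtain ⟨j, rfl⟩ : ∃ j, k = j + 1 := ⟨k - 1, by omega⟩
        have h1 := h.eval_mul_pos (k := j) (by omega) (ho (j + 1) j rfl hi).1 (by omega)
        have h2 := h.lead_mul_eval_derivative_pos (k := j) (by omega)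
        have h3 := h.coeff_odd (by rw [Nat.odd_iff]; omega)
        have hl : q.leadingCoeff = g.coeff (n / 2) := by
          rw [leadingCoeff, hqn, show n = 2 * (n / 2) + 1 by omega,
            coeff_two_mul_add_one_of_parts]
          congr 1; omega
        obtain ⟨M, hM, h4⟩ := exists_gt_leadingCoeff_mul_eval_pos hq0 √(o (j + 1))
        rw [hl] at h4
        obtain ⟨c, hc1, -, hc⟩ := exists_root_of_eval_mul_eval_neg q hM (by
          rw [(hqo _ hi).1]
          have h5 := mul_pos (mul_pos (mul_pos h1 h2) h4) (neg_pos.2 h3)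
          have h6 : 0 < (a * g.coeff (n / 2) * (derivative f).eval (e j)) ^ 2 *
            -(f.eval (o (j + 1)) * q.eval M) := by linarith
          linarith [pos_of_mul_pos_right h6 (sq_nonneg _)])
        exact ⟨c, fun _ => ⟨hc1, fun _ => by omega, hc⟩⟩
    · have hk : k < n / 2 := by omega
      simp only [(odd_two_mul_add_one k).neg_one_pow, neg_one_mul, hto,
        show 2 * k + 1 + 1 = 2 * (k + 1) by ring, hte]
      by_cases hk2 : 2 * (k + 1) < n
      · have h1 := h.eval_mul_pos hk (ho (k + 1) k rfl hk2).1 (ho (k + 1) k rfl hk2).2.1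
        have h2 := h.eval_mul_eval_pos hk h1
        obtain ⟨c, hc1, hc2, hc⟩ := exists_root_of_eval_mul_eval_neg (q.comp (-X))
          (Real.sqrt_lt_sqrt (h.pos k hk).le (ho (k + 1) k rfl hk2).1) (by
            simp only [eval_comp, eval_neg, eval_X]
            rw [(hqo _ hk2).2, (hqee k hk).2]
            linarith [mul_pos h2 (hsqrt k hk)])
        simp only [eval_comp, eval_neg, eval_X] at hc
        exact ⟨c, fun _ => ⟨hc1, fun _ => hc2, hc⟩⟩
      · have hne : n = 2 * (n / 2) := by omega
        have hev : Even n := by rw [Nat.even_iff]; omega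
        have h2 := h.eval_mul_eval_pos hk (h.lead_mul_eval_derivative_pos (k := k) (by omega))
        have hl : (q.comp (-X)).leadingCoeff = a := by
          rw [leadingCoeff_comp (by simp), leadingCoeff_neg, leadingCoeff_X, hqn, hev.neg_one_pow,
            mul_one, leadingCoeff, hqn, hne, coeff_two_mul_of_parts, ← h.natDegree_eq,
            coeff_natDegree, h.leadingCoeff_eq]
        obtain ⟨M, hM, h4⟩ := exists_gt_leadingCoeff_mul_eval_pos (p := q.comp (-X))
          (leadingCoeff_ne_zero.1 (hl ▸ h.ne_zero)) √(e k)
        rw [hl] at h4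
        obtain ⟨c, hc1, -, hc⟩ := exists_root_of_eval_mul_eval_neg (q.comp (-X)) hM (by
          have h5 := mul_pos (mul_pos h2 h4) (hsqrt k hk)
          have h6 : 0 < a ^ 2 * (√(e k) * g.eval (e k) * (q.comp (-X)).eval M) := by linarith
          have h7 := pos_of_mul_pos_right h6 (sq_nonneg _)
          rw [eval_comp, eval_neg, eval_X, (hqee k hk).2]
          linarith)
        simp only [eval_comp, eval_neg, eval_X] at hc
        exact ⟨c, fun _ => ⟨hc1, fun _ => by omega, hc⟩⟩
  choose m hm using hex
  exact AlternatingRoots.of_intervals hqn hq0 (t := t) (m := m) (Real.sqrt_nonneg _ |>.trans_eq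
    (hte 0).symm) (fun i hi => (hm i hi).1) (fun i hi => (hm i (by omega)).2.1 hi)
    (fun i hi => (hm i hi).2.2)

end InterlacingParts

lemma prod_mul_prod_pos {n : ℕ} {σ a : ℕ → ℝ} (h : ∀ i < n, 0 < σ i * a i) :
    0 < (∏ i ∈ Finset.range n, σ i) * ∏ i ∈ Finset.range n, a i := by
  rw [← Finset.prod_mul_distrib]
  exact Finset.prod_pos fun i hi => h i (Finset.mem_range.1 hi)

lemma prod_ite_lt_neg_one {n j : ℕ} (hj : j ≤ n) :
    ∏ i ∈ Finset.range n, (if i < j then (-1 : ℝ) else 1) = (-1) ^ j := by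
  rw [Finset.prod_ite, Finset.prod_const_one, mul_one, Finset.prod_const]
  have : (Finset.range n).filter (· < j) = Finset.range j := by
    ext i
    simp only [Finset.mem_filter, Finset.mem_range]
    omega
  rw [this, Finset.card_range]

lemma AlternatingRoots.interlacingParts {n : ℕ} {f g : ℝ[X]}
    (h : AlternatingRoots n (f.comp (X ^ 2) + X * g.comp (X ^ 2))) :
    ∃ e a, InterlacingParts n f g e a := by
  obtain ⟨m, b, hb, hm, hpos, hq⟩ := h
  have hlt : ∀ i j, i < j → j < n → m i < m j := fun i j hij hj =>
    hm (by simp; omega) (by simpa) hij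
  have hcoeff : ∀ N, n < N → (f.comp (X ^ 2) + X * g.comp (X ^ 2)).coeff N = 0 := fun N hN => by
    rw [hq]
    refine coeff_eq_zero_of_natDegree_lt ?_
    rwa [natDegree_C_mul hb, Lagrange.natDegree_nodal, Finset.card_range]
  have hlead : (f.comp (X ^ 2) + X * g.comp (X ^ 2)).coeff n = b := by
    rw [hq, coeff_C_mul]
    have : (Lagrange.nodal (Finset.range n) fun i => (-1) ^ i * m i).coeff n = 1 := by
      convert (Lagrange.nodal_monic (s := Finset.range n)
        (v := fun i => (-1) ^ i * m i)).coeff_natDegree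
      rw [Lagrange.natDegree_nodal, Finset.card_range]
    rw [this, mul_one]
  have heval : ∀ x, f.eval (x ^ 2) + x * g.eval (x ^ 2)
      = b * ∏ i ∈ Finset.range n, (x - (-1) ^ i * m i) := fun x => by
    rw [← eval_of_parts, hq, eval_C_mul, Lagrange.eval_nodal]
  have hroot : ∀ i < n, f.eval (m i ^ 2) + ((-1) ^ i * m i) * g.eval (m i ^ 2) = 0 := by
    intro i hi
    have := heval ((-1) ^ i * m i)
    rw [Finset.prod_eq_zero (Finset.mem_range.2 hi) (sub_self _), mul_zero, mul_pow, ← pow_mul,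
      mul_comm i 2, pow_mul, neg_one_sq, one_pow, one_mul] at this
    exact this
  have hbsq : 0 < b ^ 2 := sq_pos_of_ne_zero hb
  have hfeven : ∀ k, 2 * k < n →
      2 * f.eval (m (2 * k) ^ 2) = b * ∏ i ∈ Finset.range n, (-m (2 * k) - (-1) ^ i * m i) := by
    intro k hk
    have h1 := hroot (2 * k) hk
    rw [(even_two_mul k).neg_one_pow] at h1
    rw [← heval, neg_sq]
    linarith
  have hfodd : ∀ k, 2 * k + 1 < n →
      2 * f.eval (m (2 * k + 1) ^ 2)
        = b * ∏ i ∈ Finset.range n, (m (2 * k + 1) - (-1) ^ i * m i) := by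
    intro k hk
    have h1 := hroot (2 * k + 1) hk
    rw [(odd_two_mul_add_one k).neg_one_pow] at h1
    rw [← heval]
    linarith
  have hsign : ∀ k < n / 2, f.eval (m (2 * k) ^ 2) * f.eval (m (2 * k + 1) ^ 2) < 0 := by
    intro k hk
    have h1 := prod_mul_prod_pos (n := n) (σ := fun i => if i < 2 * k + 1 then -1 else 1)
      (a := fun i => (-m (2 * k) - (-1) ^ i * m i) * (m (2 * k + 1) - (-1) ^ i * m i)) (by
        intro i hi
        have h0 := hpos i hi
        have h0' := hpos (2 * k) (by omega)
        have h0'' := hpos (2 * k + 1) (by omega)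
        rcases Nat.even_or_odd i with hi2 | hi2
        · simp only [hi2.neg_one_pow, one_mul]
          rw [Nat.even_iff] at hi2
          split_ifs with hik
          · have := hlt i (2 * k + 1) hik (by omega)
            linarith [mul_pos_of_neg_of_neg (show -m (2 * k) - m i < 0 by linarith)
              (show m i - m (2 * k + 1) < 0 by linarith)]
          · have := hlt (2 * k + 1) i (by omega) (by omega)
            linarith [mul_pos_of_neg_of_neg (show -m (2 * k) - m i < 0 by linarith)
              (show m (2 * k + 1) - m i < 0 by linarith)]
        · simp only [hi2.neg_one_pow]
          rw [Nat.odd_iff] at hi2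
          split_ifs with hik
          · have := hlt i (2 * k) (by omega) (by omega)
            linarith [mul_pos (show 0 < m (2 * k) - m i by linarith)
              (show 0 < m (2 * k + 1) + m i by linarith)]
          · have := hlt (2 * k) i (by omega) (by omega)
            linarith [mul_pos (show 0 < m i - m (2 * k) by linarith)
              (show 0 < m (2 * k + 1) + m i by linarith)])
    rw [prod_ite_lt_neg_one (by omega), (odd_two_mul_add_one k).neg_one_pow,
      Finset.prod_mul_distrib] at h1
    have h2 := mul_pos hbsq h1
    have h3 : (2 * f.eval (m (2 * k) ^ 2)) * (2 * f.eval (m (2 * k + 1) ^ 2)) < 0 := by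
      rw [hfeven k (by omega), hfodd k (by omega)]
      linarith
    linarith
  have hex : ∀ k, ∃ x, k < n / 2 → m (2 * k) < x ∧ x < m (2 * k + 1) ∧ f.eval (x ^ 2) = 0 := by
    intro k
    by_cases hk : k < n / 2
    · obtain ⟨x, h1, h2, h3⟩ := exists_root_of_eval_mul_eval_neg (f.comp (X ^ 2))
        (hlt (2 * k) (2 * k + 1) (by omega) (by omega)) (by simpa using hsign k hk)
      exact ⟨x, fun _ => ⟨h1, h2, by simpa using h3⟩⟩
    · exact ⟨0, fun h => absurd h hk⟩
  choose x hx using hex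
  have hxpos : ∀ k < n / 2, 0 < x k := fun k hk => (hpos _ (by omega)).trans (hx k hk).1
  have hxlt : ∀ i j, i < j → j < n / 2 → m (2 * i + 1) < x j := fun i j hij hj =>
    (hlt (2 * i + 1) (2 * j) (by omega) (by omega)).trans (hx j hj).1
  have hmono : StrictMonoOn (fun k => x k ^ 2) (Finset.range (n / 2)) := by
    intro i hi j hj hij
    simp only [Finset.coe_range, Set.mem_Iio] at hi hj
    have := hxpos i hi
    exact pow_lt_pow_left₀ ((hx i hi).2.1.trans (hxlt i j hij hj)) this.le two_ne_zero
  have hfdeg : f.natDegree ≤ n / 2 := natDegree_le_iff_coeff_eq_zero.2 fun N hN => by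
    rw [← coeff_two_mul_of_parts f g]
    exact hcoeff _ (by omega)
  have hfn : f = C (f.coeff (n / 2)) * Lagrange.nodal (Finset.range (n / 2)) fun k => x k ^ 2 := by
    have := eq_C_coeff_mul_nodal (s := Finset.range (n / 2)) hmono.injOn (f := f)
      (by rwa [Finset.card_range]) (fun i hi => (hx i (Finset.mem_range.1 hi)).2.2)
    rwa [Finset.card_range] at this
  have hodd : Odd n → f.coeff (n / 2) * g.coeff (n / 2) < 0 := by
    rintro ⟨k, hk⟩
    have hkn : n / 2 = k := by omega
    have hg : g.coeff (n / 2) = b := by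
      rw [hkn, ← coeff_two_mul_add_one_of_parts f g, ← hk, hlead]
    have h1 := prod_mul_prod_pos (n := n) (σ := fun i => if i < n then -1 else 1)
      (a := fun i => -m (2 * k) - (-1) ^ i * m i) (by
        intro i hi
        have h0 := hpos i hi
        have h0' := hpos (2 * k) (by omega)
        rcases Nat.even_or_odd i with hi2 | hi2
        · simp only [hi2.neg_one_pow, if_pos hi]
          linarith
        · simp only [hi2.neg_one_pow, if_pos hi]
          rw [Nat.odd_iff] at hi2
          linarith [hlt i (2 * k) (by omega) (by omega)])
    rw [prod_ite_lt_neg_one le_rfl, hk, (odd_two_mul_add_one k).neg_one_pow, ← hk] at h1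
    have h2 := mul_pos hbsq h1
    have h3 := hfeven k (by omega)
    have h4 : 0 < ∏ i ∈ Finset.range (n / 2), (m (2 * k) ^ 2 - x i ^ 2) := by
      refine Finset.prod_pos fun i hi => sub_pos.2 ?_
      have hi' := Finset.mem_range.1 hi
      exact pow_lt_pow_left₀ ((hx i hi').2.1.trans (hlt _ _ (by omega) (by omega)))
        (hxpos i hi').le two_ne_zero
    rw [hfn, eval_C_mul, Lagrange.eval_nodal] at h3
    rw [hg]
    have h5 : 0 < (∏ i ∈ Finset.range (n / 2), (m (2 * k) ^ 2 - x i ^ 2))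
        * -(f.coeff (n / 2) * b) := by
      have := congrArg (b * ·) h3
      linarith
    linarith [pos_of_mul_pos_right h5 h4.le]
  have ha : f.coeff (n / 2) ≠ 0 := by
    rcases Nat.even_or_odd n with hev | hod
    · rw [← coeff_two_mul_of_parts f g, Nat.two_mul_div_two_of_even hev, hlead]
      exact hb
    · exact left_ne_zero_of_mul (hodd hod).ne
  have hroots : PositiveSimpleRoots (n / 2) f (fun k => x k ^ 2) (f.coeff (n / 2)) :=
    ⟨ha, hmono, fun k hk => pow_pos (hxpos k hk) 2, hfn⟩
  refine ⟨_, _, hroots, fun k hk => ?_, ?_, fun hev => ?_, hodd⟩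
  · have h1 := hroots.eval_mul_pos hk (u := m (2 * k + 1) ^ 2)
      (pow_lt_pow_left₀ (hx k hk).2.1 (hxpos k hk).le two_ne_zero) fun hk1 =>
        pow_lt_pow_left₀ (hxlt k (k + 1) (by omega) hk1) (hpos _ (by omega)).le two_ne_zero
    have h2 := heval (x k)
    rw [(hx k hk).2.2, zero_add] at h2
    have h3 : 0 < ∏ i ∈ Finset.range n,
        ((x k - (-1) ^ i * m i) * (m (2 * k + 1) - (-1) ^ i * m i)) := by
      refine Finset.prod_pos fun i hi => ?_
      rw [Finset.mem_range] at hi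
      have h0 := hpos i hi
      have hx1 := (hx k hk).1
      have hx2 := (hx k hk).2.1
      have hx0 := hxpos k hk
      rcases Nat.even_or_odd i with hi2 | hi2
      · simp only [hi2.neg_one_pow, one_mul]
        rw [Nat.even_iff] at hi2
        rcases (show i ≤ 2 * k ∨ 2 * k + 1 < i by omega) with hik | hik
        · have : m i ≤ m (2 * k) := hm.monotoneOn (by simpa) (by simp; omega) hik
          exact mul_pos (by linarith) (by linarith)
        · have := hlt _ _ hik hi
          exact mul_pos_of_neg_of_neg (by linarith) (by linarith)
      · simp only [hi2.neg_one_pow]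
        exact mul_pos (by linarith) (by linarith)
    rw [Finset.prod_mul_distrib] at h3
    have h4 := mul_pos hbsq h3
    have h5 : 0 < (x k * g.eval (x k ^ 2)) * (2 * f.eval (m (2 * k + 1) ^ 2)) := by
      rw [h2, hfodd k (by omega)]
      linarith
    have h6 := mul_pos h5 h1
    have h7 : 0 < (x k * f.eval (m (2 * k + 1) ^ 2) ^ 2) *
      (g.eval (x k ^ 2) * (derivative f).eval (x k ^ 2)) := by linarith
    exact pos_of_mul_pos_right h7 (mul_nonneg (hxpos k hk).le (sq_nonneg _))
  · refine natDegree_le_iff_coeff_eq_zero.2 fun N hN => ?_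
    rw [← coeff_two_mul_add_one_of_parts f g]
    exact hcoeff _ (by omega)
  · rw [← coeff_two_mul_add_one_of_parts f g]
    exact hcoeff _ (by rw [Nat.even_iff] at hev; omega)

lemma nodal_comp_C_mul_X {s : ℝ} (hs : s * s = 1) (n : ℕ) (v : ℕ → ℝ) :
    (Lagrange.nodal (Finset.range n) v).comp (C s * X)
      = C (s ^ n) * Lagrange.nodal (Finset.range n) (fun i => s * v i) := by
  rw [Lagrange.nodal_eq, Lagrange.nodal_eq, Polynomial.prod_comp]
  have h : ∀ i ∈ Finset.range n, (X - C (v i)).comp (C s * X) = C s * (X - C (s * v i)) := by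
    intro i _
    rw [sub_comp, X_comp, C_comp, mul_sub, ← C_mul, ← mul_assoc, hs, one_mul]
  rw [Finset.prod_congr rfl h, Finset.prod_mul_distrib, Finset.prod_const, Finset.card_range,
    C_pow]

lemma neg_one_pow_mul_self (n : ℕ) : (-1 : ℝ) ^ n * (-1) ^ n = 1 := by
  rw [← mul_pow]; norm_num

lemma neg_one_pow_mul_reflect {n i : ℕ} (hi : i < n) :
    (-1 : ℝ) ^ (n + 1) * (-1) ^ (n - 1 - i) = (-1) ^ i := by
  rw [← pow_add, show n + 1 + (n - 1 - i) = 2 * (n - i) + i by omega, pow_add, pow_mul,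
    neg_one_sq, one_pow, one_mul]

/-- A polynomial of degree `n` is self-interlacing of kind I if, after the substitution
`z ↦ (-1) ^ (n + 1) * z` making the root of smallest absolute value positive, its roots
alternate in sign when ordered by increasing absolute value. -/
lemma selfInterlacingI_of_alternatingRoots {n : ℕ} {p : ℝ[X]}
    (h : AlternatingRoots n (p.comp (C ((-1) ^ (n + 1)) * X))) : SelfInterlacingI p := by
  obtain ⟨m, b, hb, hm, hpos, hq⟩ := h
  set s : ℝ := (-1) ^ (n + 1) with hs
  have hss : s * s = 1 := neg_one_pow_mul_self _
  have hs0 : s ≠ 0 := left_ne_zero_of_mul_eq_one hss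
  have hp : p = C (b * s ^ n) *
      Lagrange.nodal (Finset.range n) (fun i => s * ((-1) ^ i * m i)) := by
    have h1 := congrArg (fun r => r.comp (C s * X)) hq
    simp only [comp_assoc, mul_comp, C_comp, X_comp] at h1
    rw [← mul_assoc, ← C_mul, hss, C_1, one_mul, comp_X, nodal_comp_C_mul_X hss, ← mul_assoc,
      ← C_mul] at h1
    exact h1
  have hn : p.natDegree = n := by
    rw [hp, natDegree_C_mul (mul_ne_zero hb (pow_ne_zero _ hs0)), Lagrange.natDegree_nodal,
      Finset.card_range]
  have hl : p.leadingCoeff = b * s ^ n := by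
    rw [hp, leadingCoeff_mul, leadingCoeff_C, Lagrange.nodal_monic.leadingCoeff, mul_one]
  have hval : ∀ i < n, (-1 : ℝ) ^ i * (s * ((-1) ^ (n - 1 - i) * m (n - 1 - i)))
      = m (n - 1 - i) := fun i hi => by
    rw [← mul_assoc s, hs, neg_one_pow_mul_reflect hi, ← mul_assoc, neg_one_pow_mul_self, one_mul]
  refine ⟨fun i => s * ((-1) ^ (n - 1 - (i : ℕ)) * m (n - 1 - i)), ?_, ?_, ?_⟩
  · rw [hl, Fin.prod_univ_eq_prod_range
      (fun i => X - C (s * ((-1) ^ (n - 1 - i) * m (n - 1 - i)))) p.natDegree, hn,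
      Finset.prod_range_reflect (fun i => X - C (s * ((-1) ^ i * m i))) n, ← Lagrange.nodal_eq]
    exact hp
  · intro i j hij
    have hi : (i : ℕ) < n := i.2.trans_eq hn
    have hj : (j : ℕ) < n := j.2.trans_eq hn
    simp only
    rw [hval i hi, hval j hj]
    have : (i : ℕ) < j := hij
    exact hm (by simp; omega) (by simp; omega) (by omega)
  · intro i
    have hi : (i : ℕ) < n := i.2.trans_eq hn
    simp only
    rw [hval i hi]
    exact hpos _ (by omega)

lemma SelfInterlacingI.alternatingRoots {p : ℝ[X]} (hp0 : p ≠ 0) (h : SelfInterlacingI p) :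
    AlternatingRoots p.natDegree (p.comp (C ((-1) ^ (p.natDegree + 1)) * X)) := by
  unfold SelfInterlacingI at h
  set n := p.natDegree
  obtain ⟨lam, hp, hanti, hpos⟩ := h
  set s : ℝ := (-1) ^ (n + 1) with hs
  have hss : s * s = 1 := neg_one_pow_mul_self _
  have hs0 : s ≠ 0 := left_ne_zero_of_mul_eq_one hss
  set v : ℕ → ℝ := fun i => if hi : i < n then lam ⟨i, hi⟩ else 0 with hv
  have hvl : ∀ i (hi : i < n), v i = lam ⟨i, hi⟩ := fun i hi => dif_pos hi
  refine ⟨fun i => (-1) ^ (n - 1 - i) * v (n - 1 - i), p.leadingCoeff * s ^ n,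
    mul_ne_zero (leadingCoeff_ne_zero.2 hp0) (pow_ne_zero _ hs0), ?_, ?_, ?_⟩
  · intro i hi j hj hij
    simp only [Finset.coe_range, Set.mem_Iio] at hi hj
    simp only
    rw [hvl _ (by omega : n - 1 - i < n), hvl _ (by omega : n - 1 - j < n)]
    exact hanti (show (⟨n - 1 - j, by omega⟩ : Fin n) < ⟨n - 1 - i, by omega⟩ from
      Fin.mk_lt_mk.2 (by omega))
  · intro i hi
    simp only
    rw [hvl _ (by omega : n - 1 - i < n)]
    exact hpos ⟨n - 1 - i, by omega⟩
  · have hp' : p = C p.leadingCoeff * Lagrange.nodal (Finset.range n) v := by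
      conv_lhs => rw [hp]
      rw [Lagrange.nodal_eq, ← Fin.prod_univ_eq_prod_range (fun i => X - C (v i)) n]
      simp only [hvl _ (Fin.is_lt _)]
    conv_lhs => rw [hp']
    rw [mul_comp, C_comp, nodal_comp_C_mul_X hss, ← mul_assoc, ← C_mul, Lagrange.nodal_eq,
      Lagrange.nodal_eq, ← Finset.prod_range_reflect]
    congr 1
    refine Finset.prod_congr rfl fun i hi => ?_
    rw [Finset.mem_range] at hi
    have h1 := neg_one_pow_mul_reflect hi
    have h2 : (-1 : ℝ) ^ i * (-1) ^ (n - 1 - i) = s := by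
      rw [← h1, mul_assoc, neg_one_pow_mul_self, mul_one]
    rw [← mul_assoc, h2]

lemma parts_comp_C_mul_X {s : ℝ} (hs : s * s = 1) (f g : ℝ[X]) :
    (f.comp (X ^ 2) + X * g.comp (X ^ 2)).comp (C s * X)
      = f.comp (X ^ 2) + X * (C s * g).comp (X ^ 2) := by
  have h : (X ^ 2 : ℝ[X]).comp (C s * X) = X ^ 2 := by
    rw [pow_comp, X_comp, mul_pow, ← C_pow, pow_two s, hs, C_1, one_mul]
  rw [add_comp, mul_comp, comp_assoc, comp_assoc, h, X_comp, mul_comp, C_comp]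
  ring

/-- If `p` of degree `n ≥ 2` with positive leading coefficient is self-interlacing of
kind I and `p(z) = pe(z²) + z·po(z²)`, then for `1 ≤ j ≤ ⌊n/2⌋ - 1` the polynomial
`p_j(z) = pe^{(j)}(z²) + z·po^{(j)}(z²)` is again self-interlacing of kind I. -/
theorem selfInterlacing_part_derivatives
    (n : ℕ) (hn : 2 ≤ n) (p pe po : Polynomial ℝ)
    (hdeg : p.natDegree = n) (hlead : 0 < p.leadingCoeff)
    (hparts : p = pe.comp (Polynomial.X ^ 2) + Polynomial.X * po.comp (Polynomial.X ^ 2))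
    (hsi : SelfInterlacingI p) :
    ∀ j, 1 ≤ j → j ≤ n / 2 - 1 →
      SelfInterlacingI
        ((Polynomial.derivative^[j] pe).comp (Polynomial.X ^ 2) +
          Polynomial.X * (Polynomial.derivative^[j] po).comp (Polynomial.X ^ 2)) := by
  intro j hj1 hj
  have hss := neg_one_pow_mul_self (n + 1)
  have hp0 : p ≠ 0 := leadingCoeff_ne_zero.1 hlead.ne'
  have h1 := hsi.alternatingRoots hp0
  obtain ⟨k, rfl⟩ : ∃ k, n = k + 2 * j := ⟨n - 2 * j, by omega⟩
  rw [hdeg, hparts, parts_comp_C_mul_X hss] at h1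
  obtain ⟨e, a, h2⟩ := h1.interlacingParts
  obtain ⟨e', a', h3⟩ := h2.iterate_derivative j
  have h4 := h3.alternatingRoots (by omega)
  have hs : (-1 : ℝ) ^ (k + 2 * j + 1) = (-1) ^ (k + 1) := by
    rw [show k + 2 * j + 1 = 2 * j + (k + 1) by ring, pow_add, pow_mul, neg_one_sq, one_pow,
      one_mul]
  rw [iterate_derivative_C_mul, hs, ← parts_comp_C_mul_X (neg_one_pow_mul_self (k + 1))] at h4
  exact selfInterlacingI_of_alternatingRoots h4
end

section
/- Let p(z) = a_0 z^n + a_1 z^{n−1} + ⋯ + a_n be a real polynomial of degree n ≥ 1 with a_0 > 0 that is self-interlacing of kind I, and let H_n(p) be its n×n Hurwitz matrix. Then for every 1 ≤ m ≤ n and all indices 1 ≤ i_1 < i_2 < ⋯ < i_m ≤ n and 1 ≤ j_1 < j_2 < ⋯ < j_m ≤ n, one has (−1)^{Σ_{k=1}^m i_k(i_k−1)/2 + Σ_{k=1}^m j_k} · det(submatrix of H_n(p) with rows i_1,…,i_m and columns j_1,…,j_m) ≥ 0. -/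
open Polynomial

/-- The coefficient `a_m` of `z^(n-m)` in `p` (where `n = p.natDegree`), with the
convention `a_m = 0` for `m < 0` or `m > n`. -/
noncomputable def aCoeff (p : Polynomial ℝ) (m : ℤ) : ℝ :=
  if 0 ≤ m ∧ m ≤ (p.natDegree : ℤ) then p.coeff (p.natDegree - m.toNat) else 0

/-- The `k`-th Hurwitz minor `Δ_k(p) = det[(a_{2j-i})]` with `i, j` running over `1, …, k`;
`Δ_0(p) = 1` (determinant of the empty matrix). -/
noncomputable def hurwitzMinor (p : Polynomial ℝ) (k : ℕ) : ℝ :=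
  Matrix.det (Matrix.of fun i j : Fin k =>
    aCoeff p (2 * ((j : ℤ) + 1) - ((i : ℤ) + 1)))

/-- `∑ₖ (-1)ᵏ b₂ₖ X^(n-2k)`, the sum running over `2k ≤ n`. -/
noncomputable def altPoly : ℕ → (ℕ → ℝ) → ℝ[X]
  | 0, b => C (b 0)
  | 1, b => C (b 0) * X
  | n + 2, b => C (b 0) * X ^ (n + 2) - altPoly n (fun k => b (k + 2))

/-- Extension of a sequence by zero to negative indices. -/
def extendZero (b : ℕ → ℝ) (k : ℤ) : ℝ := if 0 ≤ k then b k.toNat else 0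

/-- The infinite Hurwitz matrix `(b_{2j-i})` has only nonnegative minors. -/
def HurwitzTNN (b : ℕ → ℝ) : Prop :=
  ∀ (m : ℕ) (r c : Fin m → ℤ), StrictMono r → StrictMono c →
    0 ≤ Matrix.det (Matrix.of fun k l : Fin m => extendZero b (2 * c l - r k))

lemma altPoly_congr {n : ℕ} {b b' : ℕ → ℝ} (h : ∀ k, b (2 * k) = b' (2 * k)) :
    altPoly n b = altPoly n b' := by
  induction n using Nat.twoStepInduction generalizing b b' with
  | zero => simp [altPoly, show b 0 = b' 0 from h 0]
  | one => simp [altPoly, show b 0 = b' 0 from h 0]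
  | more n ih _ =>
    rw [altPoly, altPoly, show b 0 = b' 0 from h 0,
      ih (b := fun k => b (k + 2)) (b' := fun k => b' (k + 2)) (fun k => h (k + 1))]

lemma altPoly_sub_smul (n : ℕ) (u v : ℕ → ℝ) (c : ℝ) :
    altPoly n (fun k => u k - c * v k) = altPoly n u - C c * altPoly n v := by
  induction n using Nat.twoStepInduction generalizing u v with
  | zero => simp [altPoly]
  | one => simp [altPoly]; ring
  | more n ih _ =>
    simp only [altPoly]
    rw [ih (fun k => u (k + 2)) (fun k => v (k + 2))]
    simp; ring

lemma X_mul_altPoly {n : ℕ} {v : ℕ → ℝ} (h : v (n + 1) = 0) :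
    X * altPoly n v = altPoly (n + 1) v := by
  induction n using Nat.twoStepInduction generalizing v with
  | zero => simp [altPoly]
  | one => simp at h; simp [altPoly, h]; ring
  | more n ih _ =>
    simp only [altPoly]
    rw [mul_sub, ih h]; ring

lemma coeff_altPoly (n : ℕ) (b : ℕ → ℝ) (i : ℕ) :
    (altPoly n b).coeff i =
      if i ≤ n ∧ Even (n - i) then (-1) ^ ((n - i) / 2) * b (n - i) else 0 := by
  induction n using Nat.twoStepInduction generalizing b with
  | zero => simp only [altPoly, coeff_C]; split_ifs <;> simp_all
  | one =>
    simp only [altPoly, coeff_C_mul, coeff_X]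
    rcases i with _ | _ | i <;> simp
  | more n ih _ =>
    simp only [altPoly, coeff_sub, coeff_C_mul, coeff_X_pow, ih]
    rcases lt_trichotomy i (n + 1) with h | rfl | h
    · have h1 : n + 2 - i = (n - i) + 2 := by omega
      have h2 : (n - i + 2) / 2 = (n - i) / 2 + 1 := by omega
      rw [h1, h2]
      have : i ≤ n := by omega
      have h3 : i ≤ n + 2 := by omega
      have h4 : i ≠ n + 2 := by omega
      simp only [this, h3, h4, true_and, Nat.even_add, even_two, iff_true, if_false]
      split_ifs <;> simp [pow_succ]
    · have : n + 2 - (n + 1) = 1 := by omega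
      simp [this]
    · have : ¬ i ≤ n := by omega
      rcases eq_or_ne i (n + 2) with rfl | h5
      · simp
      · have h3 : ¬ i ≤ n + 2 := by omega
        simp [this, h3, h5]

lemma natDegree_altPoly_le (n : ℕ) (b : ℕ → ℝ) : (altPoly n b).natDegree ≤ n := by
  rw [natDegree_le_iff_coeff_eq_zero]
  intro i hi
  rw [coeff_altPoly, if_neg (by omega)]

lemma eval_neg_altPoly (n : ℕ) (b : ℕ → ℝ) (z : ℝ) :
    (altPoly n b).eval (-z) = (-1) ^ n * (altPoly n b).eval z := by
  induction n using Nat.twoStepInduction generalizing b with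
  | zero => simp [altPoly]
  | one => simp [altPoly]
  | more n ih _ =>
    simp only [altPoly, eval_sub, eval_mul, eval_C, eval_pow, eval_X, ih]
    rw [neg_pow z]; ring

/-- The sequence obtained from `b` by one step of the Routh scheme. -/
def routhStep (c : ℝ) (b : ℕ → ℝ) (k : ℕ) : ℝ :=
  if Even k then b (k + 1) else b (k + 1) - c * b (k + 2)

lemma altPoly_routhStep (n : ℕ) (c : ℝ) (b : ℕ → ℝ) :
    altPoly n (routhStep c b) = altPoly n (fun k => b (k + 1)) :=
  altPoly_congr fun k => by simp [routhStep]

lemma altPoly_shift_routhStep {n : ℕ} {c : ℝ} {b : ℕ → ℝ} (h0 : b 0 = c * b 1)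
    (hb : ∀ k, n + 2 < k → b k = 0) :
    altPoly n (fun k => routhStep c b (k + 1)) =
      C c * X * altPoly (n + 1) (fun k => b (k + 1)) - altPoly (n + 2) b := by
  have h1 : altPoly n (fun k => routhStep c b (k + 1)) =
      altPoly n (fun k => b (k + 2) - c * b (k + 3)) :=
    altPoly_congr fun k => by simp [routhStep]
  rw [h1, altPoly_sub_smul n (fun k => b (k + 2)) (fun k => b (k + 3)), mul_assoc,
    X_mul_altPoly (v := fun k => b (k + 1)) (hb _ (by omega))]
  simp only [altPoly, h0]
  simp; ring

lemma extendZero_eq_routhStep {c : ℝ} {b : ℕ → ℝ} (h0 : b 0 = c * b 1) (k : ℤ) :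
    extendZero b k = extendZero (routhStep c b) (k - 1) +
      (if Even k then c else 0) * extendZero (routhStep c b) k := by
  rcases lt_trichotomy k 0 with h | rfl | h
  · simp [extendZero, show ¬ 0 ≤ k by omega, show ¬ 1 ≤ k by omega]
  · simp [extendZero, routhStep, h0]
  · obtain ⟨j, rfl⟩ : ∃ j : ℕ, k = j + 1 := ⟨(k - 1).toNat, by omega⟩
    have h1 : ((j : ℤ) + 1).toNat = j + 1 := by omega
    have h2 : (0 : ℤ) ≤ (j : ℤ) + 1 := by omega
    simp only [extendZero, add_sub_cancel_right, h1, h2, if_true, Int.toNat_natCast,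
      Int.natCast_nonneg, routhStep, Nat.even_add_one, Int.even_add_one, Int.even_coe_nat]
    split_ifs <;> simp_all

lemma hurwitzTNN_of_eq_zero_of_pos {b : ℕ → ℝ} (h0 : 0 ≤ b 0) (hb : ∀ k, 0 < k → b k = 0) :
    HurwitzTNN b := by
  have hz : ∀ k : ℤ, k ≠ 0 → extendZero b k = 0 := by
    intro k hk
    unfold extendZero
    split_ifs with h
    · exact hb _ (by omega)
    · rfl
  have hnn : ∀ k : ℤ, 0 ≤ extendZero b k := by
    intro k
    rcases eq_or_ne k 0 with rfl | hk
    · simpa [extendZero] using h0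
    · rw [hz k hk]
  intro m r c hr hc
  rw [Matrix.det_apply, Finset.sum_eq_single 1]
  · simpa using Finset.prod_nonneg fun k _ => hnn _
  · intro σ _ hσ
    rw [smul_eq_zero_iff_eq]
    by_contra hne
    rw [← ne_eq, Finset.prod_ne_zero_iff] at hne
    apply hσ
    have hrc : ∀ k, r (σ k) = 2 * c k := by
      intro k
      by_contra hk
      exact hne k (Finset.mem_univ _) (hz _ (by omega))
    have hmono : StrictMono σ := by
      intro i j hij
      rw [← hr.lt_iff_lt, hrc, hrc]
      have := hc hij
      omega
    have : (σ : Fin m → Fin m) = id :=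
      (hmono.range_inj strictMono_id).mp (by simp)
    ext k
    simp [this]
  · simp

lemma HurwitzTNN.of_routhStep {c : ℝ} {b : ℕ → ℝ} (hc : 0 ≤ c) (h0 : b 0 = c * b 1)
    (h : HurwitzTNN (routhStep c b)) : HurwitzTNN b := by
  intro m r q hr hq
  set M : ℤ → Fin m → ℝ := fun i l => extendZero (routhStep c b) (2 * q l - i) with hM
  set w : Fin m → ℝ := fun k => if Even (r k) then c else 0 with hw
  have hrow : (Matrix.of fun k l : Fin m => extendZero b (2 * q l - r k)) =
      (fun k => M (r k + 1)) + fun k => w k • M (r k) := by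
    ext k l
    simp only [Matrix.of_apply, Pi.add_apply, Pi.smul_apply, smul_eq_mul, hM, hw]
    rw [extendZero_eq_routhStep h0]
    simp [Int.even_sub, sub_sub]
  rw [hrow]
  change 0 ≤ Matrix.detRowAlternating.toMultilinearMap _
  rw [MultilinearMap.map_add_univ]
  refine Finset.sum_nonneg fun s _ => ?_
  have hpw : (s.piecewise (fun k => M (r k + 1)) fun k => w k • M (r k)) =
      fun k => (if k ∈ s then 1 else w k) • M (if k ∈ s then r k + 1 else r k) := by
    ext k l
    by_cases hk : k ∈ s <;> simp [hk]
  rw [hpw, MultilinearMap.map_smul_univ]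
  refine mul_nonneg (Finset.prod_nonneg fun k _ => ?_) ?_
  · simp only [hw]; split_ifs <;> simp [hc]
  set r' : Fin m → ℤ := fun k => if k ∈ s then r k + 1 else r k with hr'
  have hmono : Monotone r' := by
    intro i j hij
    rcases hij.eq_or_lt with rfl | hij
    · exact le_rfl
    · have := hr hij
      simp only [hr']; split_ifs <;> omega
  by_cases hinj : Function.Injective r'
  · exact h m r' q (hmono.strictMono_of_injective hinj) hq
  · simp only [Function.Injective, not_forall] at hinj
    obtain ⟨i, j, hij, hne⟩ := hinj
    refine le_of_eq (Eq.symm ?_)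
    refine Matrix.detRowAlternating.map_eq_zero_of_eq (fun k => M (r' k)) (i := i) (j := j) ?_ hne
    simp only [hij]

lemma prod_sub_sign {n : ℕ} {x : Fin n → ℝ} (k : ℕ) (hk : k ≤ n) {z : ℝ}
    (h1 : ∀ j : Fin n, (j : ℕ) < k → z < x j) (h2 : ∀ j : Fin n, k ≤ (j : ℕ) → x j < z) :
    0 < (-1) ^ k * ∏ j, (z - x j) := by
  have hsign : ∏ j : Fin n, (if (j : ℕ) < k then (-1 : ℝ) else 1) = (-1) ^ k := by
    rw [Finset.prod_ite, Finset.prod_const, Finset.prod_const_one, mul_one,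
      Fin.card_filter_val_lt, min_eq_right hk]
  rw [← hsign, ← Finset.prod_mul_distrib]
  refine Finset.prod_pos fun j _ => ?_
  split_ifs with h
  · linarith [h1 j h]
  · linarith [h2 j (not_lt.mp h)]

lemma exists_interlacing_roots {n : ℕ} {x : Fin (n + 1) → ℝ} (hx : StrictAnti x) (f : ℝ[X])
    (hf : ∀ i : Fin (n + 1), 0 < (-1) ^ (i : ℕ) * f.eval (x i)) :
    ∃ y : Fin n → ℝ, StrictAnti y ∧ (∀ i, f.eval (y i) = 0) ∧
      ∀ i : Fin n, x i.succ < y i ∧ y i < x i.castSucc := by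
  have key : ∀ i : Fin n, ∃ y, f.eval y = 0 ∧ x i.succ < y ∧ y < x i.castSucc := by
    intro i
    have hlt : x i.succ < x i.castSucc := hx (Fin.castSucc_lt_succ)
    have ha := hf i.castSucc
    have hb := hf i.succ
    have hcont : ContinuousOn (fun z => (-1) ^ (i : ℕ) * f.eval z)
        (Set.Icc (x i.succ) (x i.castSucc)) := by fun_prop
    obtain ⟨y, hy, hy0⟩ := intermediate_value_Ioo hlt.le hcont
      (show (0 : ℝ) ∈ Set.Ioo _ _ by
        constructor
        · simp only [Fin.val_succ, pow_succ] at hb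
          linarith
        · simpa using ha)
    refine ⟨y, ?_, hy.1, hy.2⟩
    simpa using hy0
  choose y hy0 hy1 hy2 using key
  refine ⟨y, ?_, hy0, fun i => ⟨hy1 i, hy2 i⟩⟩
  intro i j hij
  calc y j < x j.castSucc := hy2 j
    _ ≤ x i.succ := hx.antitone (by simpa [Fin.le_def, Nat.succ_le_iff] using hij)
    _ < y i := hy1 i

lemma eq_C_mul_prod_of_roots {n : ℕ} {f : ℝ[X]} (hf : f.natDegree ≤ n) {y : Fin n → ℝ}
    (hy : Function.Injective y) (h0 : ∀ i, f.eval (y i) = 0) :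
    f = C (f.coeff n) * ∏ i, (X - C (y i)) := by
  have hmonic : (∏ i, (X - C (y i))).Monic := monic_prod_of_monic _ _ fun i _ => monic_X_sub_C _
  have hdvd : ∏ i, (X - C (y i)) ∣ f := by
    refine Finset.prod_dvd_of_coprime (fun i _ j _ hij => ?_) fun i _ => ?_
    · exact pairwise_coprime_X_sub_C hy hij
    · exact dvd_iff_isRoot.mpr (h0 i)
  obtain ⟨g, hg⟩ := hdvd
  have hdeg : (∏ i, (X - C (y i))).natDegree = n := by
    simp
  have hg0 : g.natDegree = 0 := by
    rcases eq_or_ne g 0 with rfl | hne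
    · simp
    · have := hmonic.natDegree_mul' hne
      rw [← hg, hdeg] at this
      omega
  obtain ⟨a, rfl⟩ := natDegree_eq_zero.mp hg0
  have hcoeff : f.coeff n = a := by
    rw [hg, coeff_mul_C]
    have := hmonic.coeff_natDegree
    rw [hdeg] at this
    rw [this, one_mul]
  rw [hcoeff, mul_comm]
  exact hg

lemma hurwitzTNN_of_interlacing (n : ℕ) (b : ℕ → ℝ) (hb : ∀ k, n < k → b k = 0) (a d : ℝ)
    (ha : 0 < a) (x : Fin n → ℝ) (hx : StrictAnti x)
    (hP : C a * ∏ i, (X - C (x i)) = altPoly n b + C d * altPoly (n - 1) (fun k => b (k + 1)))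
    (hB : ∀ i : Fin n, 0 < (-1) ^ (i : ℕ) * (altPoly (n - 1) (fun k => b (k + 1))).eval (x i)) :
    HurwitzTNN b := by
  induction n generalizing b a d with
  | zero =>
    refine hurwitzTNN_of_eq_zero_of_pos ?_ hb
    have := congrArg (eval 0) hP
    simp [altPoly, hb 1 (by omega)] at this
    rw [← this]; exact ha.le
  | succ n ih =>
    simp only [Nat.add_sub_cancel] at hP hB
    obtain ⟨y, hy, hy0, hxy⟩ := exists_interlacing_roots hx _ hB
    have hfac := eq_C_mul_prod_of_roots (natDegree_altPoly_le n _) hy.injective hy0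
    have hcoeff : (altPoly n (fun k => b (k + 1))).coeff n = b 1 := by simp [coeff_altPoly]
    rw [hcoeff] at hfac
    have hb1 : 0 < b 1 := by
      have h := hB 0
      have hprod : 0 < ∏ i, (x 0 - y i) := Finset.prod_pos fun i _ => by
        have h1 := (hxy i).2
        have h2 : x i.castSucc ≤ x 0 := hx.antitone (Fin.zero_le _)
        linarith
      rw [hfac] at h
      simp only [Fin.val_zero, pow_zero, one_mul, eval_mul, eval_C, eval_prod, eval_sub,
        eval_X] at h
      exact pos_of_mul_pos_left h hprod.le
    have hb0 : 0 < b 0 := by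
      have h := congrArg (fun q => q.coeff (n + 1)) hP
      have hmonic : (∏ i, (X - C (x i))).Monic :=
        monic_prod_of_monic _ _ fun i _ => monic_X_sub_C _
      have h1 := hmonic.coeff_natDegree
      rw [natDegree_finsetProd_X_sub_C_eq_card] at h1
      simp only [Finset.card_univ, Fintype.card_fin] at h1
      simp [coeff_altPoly, h1] at h
      linarith
    have hrec : b 0 = b 0 / b 1 * b 1 := by field_simp
    refine HurwitzTNN.of_routhStep (div_pos hb0 hb1).le hrec ?_
    set c := b 0 / b 1
    refine ih (routhStep c b) ?_ (b 1) 0 hb1 y hy ?_ ?_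
    · intro k hk
      simp [routhStep, hb (k + 1) (by omega), hb (k + 2) (by omega)]
    · rw [altPoly_routhStep, hfac]; simp
    · intro i
      obtain ⟨n, rfl⟩ : ∃ n', n = n' + 1 := ⟨n - 1, by have := i.2; omega⟩
      simp only [Nat.add_sub_cancel]
      rw [altPoly_shift_routhStep hrec (fun k hk => hb k (by omega))]
      have hPy := congrArg (eval (y i)) hP
      simp only [eval_mul, eval_C, eval_prod, eval_sub, eval_X, eval_add, hy0, mul_zero,
        add_zero] at hPy
      have hsign := prod_sub_sign (x := x) (z := y i) ((i : ℕ) + 1) (by omega)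
        (fun j hj => (hxy i).2.trans_le (hx.antitone (by
          rw [Fin.le_def, Fin.val_castSucc]; omega)))
        (fun j hj => lt_of_le_of_lt (hx.antitone (by
          rw [Fin.le_def, Fin.val_succ]; omega)) (hxy i).1)
      have := mul_pos ha hsign
      simp only [eval_sub, eval_mul, hy0, mul_zero, zero_sub, ← hPy]
      rw [pow_succ] at this
      linarith

/-- The sign `(-1)^(k(k+1)/2)` times the coefficient of `X^(n-k)` of a polynomial of
degree `n`. -/
noncomputable def signedCoeff (p : ℝ[X]) (k : ℕ) : ℝ :=
  if k ≤ p.natDegree then (-1) ^ (k * (k + 1) / 2) * p.coeff (p.natDegree - k) else 0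

lemma eq_altPoly_sub_altPoly {p : ℝ[X]} {n : ℕ} (hp : p.natDegree = n + 1) :
    p = altPoly (n + 1) (signedCoeff p) - altPoly n (fun k => signedCoeff p (k + 1)) := by
  ext i
  rw [coeff_sub, coeff_altPoly, coeff_altPoly]
  rcases lt_or_ge (n + 1) i with h | h
  · rw [coeff_eq_zero_of_natDegree_lt (by omega), if_neg (by omega), if_neg (by omega)]
    simp
  · obtain ⟨k, hk⟩ := Nat.exists_eq_add_of_le h
    have e1 : n + 1 - i = k := by omega
    have e2 : n + 1 - k = i := by omega
    rcases Nat.even_or_odd' k with ⟨t, rfl | rfl⟩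
    · rw [if_pos ⟨h, by simp [e1]⟩, if_neg, e1]
      · rw [signedCoeff, hp, if_pos (by omega), e2, ← mul_assoc, ← pow_add]
        have : 2 * t / 2 + 2 * t * (2 * t + 1) / 2 = 2 * (t * (t + 1)) := by
          rw [mul_assoc, Nat.mul_div_cancel_left _ two_pos, Nat.mul_div_cancel_left _ two_pos]
          ring
        rw [this, pow_mul]
        simp
      · rintro ⟨h1, h2⟩
        rw [Nat.even_iff] at h2; omega
    · have e3 : n - i = 2 * t := by omega
      rw [if_neg, if_pos ⟨by omega, by simp [e3]⟩, e3]
      · rw [signedCoeff, hp, if_pos (by omega), e2, ← mul_assoc, ← pow_add]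
        have : 2 * t / 2 + (2 * t + 1) * (2 * t + 1 + 1) / 2 = 2 * (t * (t + 2)) + 1 := by
          rw [show (2 * t + 1) * (2 * t + 1 + 1) = 2 * ((2 * t + 1) * (t + 1)) by ring,
            Nat.mul_div_cancel_left _ two_pos, Nat.mul_div_cancel_left _ two_pos]
          ring
        rw [this, pow_succ, pow_mul]
        simp
      · rintro ⟨h1, h2⟩
        rw [Nat.even_iff] at h2; omega

lemma two_mul_eval_altPoly_of_isRoot {p : ℝ[X]} {n : ℕ} (hp : p.natDegree = n + 1) {z : ℝ}
    (hz : p.eval z = 0) :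
    2 * (altPoly n (fun k => signedCoeff p (k + 1))).eval z = (-1) ^ (n + 1) * p.eval (-z) := by
  have h := eq_altPoly_sub_altPoly hp
  have h1 := congrArg (eval z) h
  have h2 := congrArg (eval (-z)) h
  rw [eval_sub] at h1 h2
  rw [eval_neg_altPoly, eval_neg_altPoly] at h2
  rw [h2]
  have : ((-1 : ℝ) ^ n) * (-1) ^ n = 1 := by rw [← mul_pow]; simp
  rw [pow_succ]
  linear_combination h1 - hz -
    ((altPoly (n + 1) (signedCoeff p)).eval z +
      (altPoly n (fun k => signedCoeff p (k + 1))).eval z) * this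

lemma prod_erase_ite_lt_neg_one {n : ℕ} (i : Fin n) :
    ∏ j ∈ Finset.univ.erase i, (if j < i then (-1 : ℝ) else 1) = (-1) ^ (i : ℕ) := by
  have hcard : (Finset.univ.filter fun j => j < i) = Finset.Iio i := by ext j; simp
  rw [Finset.prod_erase _ (by simp), Finset.prod_ite, Finset.prod_const,
    Finset.prod_const_one, mul_one, hcard, Fin.card_Iio]

lemma eval_mul_prod_sub_pos {n : ℕ} {p : ℝ[X]} (hdeg : p.natDegree = n + 1) {a : ℝ} (ha : 0 < a)
    {lam : Fin (n + 1) → ℝ} (hp : p = C a * ∏ i, (X - C (lam i)))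
    (hanti : StrictAnti fun i : Fin (n + 1) => (-1 : ℝ) ^ (i : ℕ) * lam i)
    (hpos : ∀ i : Fin (n + 1), 0 < (-1 : ℝ) ^ (i : ℕ) * lam i) (i : Fin (n + 1)) :
    0 < (altPoly n (fun k => signedCoeff p (k + 1))).eval (lam i) *
      ∏ j ∈ Finset.univ.erase i, (lam i - lam j) := by
  have hroot : p.eval (lam i) = 0 := by
    rw [hp, eval_mul, eval_prod, Finset.prod_eq_zero (Finset.mem_univ i) (by simp), mul_zero]
  have h := two_mul_eval_altPoly_of_isRoot hdeg hroot
  have hneg : (-1) ^ (n + 1) * p.eval (-lam i) = a * ∏ j, (lam i + lam j) := by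
    have h1 : ∏ j, (lam i + lam j) = ∏ j, (-1) * (-lam i - lam j) :=
      Finset.prod_congr rfl fun j _ => by ring
    rw [h1, Finset.prod_mul_distrib, hp]
    simp only [eval_mul, eval_C, eval_prod, eval_sub, eval_X, Finset.prod_const,
      Finset.card_univ, Fintype.card_fin]
    ring
  rw [hneg, ← Finset.mul_prod_erase _ _ (Finset.mem_univ i)] at h
  have hsq : ∀ j : Fin (n + 1), ((-1 : ℝ) ^ (j : ℕ) * lam j) ^ 2 = lam j ^ 2 := fun j => by
    rw [mul_pow, ← pow_mul, mul_comm (j : ℕ), pow_mul]; simp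
  have hprod : 0 < (-1) ^ (i : ℕ) *
      ∏ j ∈ Finset.univ.erase i, ((lam i + lam j) * (lam i - lam j)) := by
    rw [← prod_erase_ite_lt_neg_one, ← Finset.prod_mul_distrib]
    refine Finset.prod_pos fun j hj => ?_
    have hne := Finset.ne_of_mem_erase hj
    have e : (lam i + lam j) * (lam i - lam j) =
        ((-1 : ℝ) ^ (i : ℕ) * lam i) ^ 2 - ((-1 : ℝ) ^ (j : ℕ) * lam j) ^ 2 := by
      rw [hsq, hsq]; ring
    rw [e]
    split_ifs with hlt
    · have := pow_lt_pow_left₀ (hanti hlt) (hpos i).le two_ne_zero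
      linarith
    · have := pow_lt_pow_left₀ (hanti (lt_of_le_of_ne (not_lt.mp hlt) hne.symm)) (hpos j).le
        two_ne_zero
      linarith
  have h1 := mul_pos (mul_pos ha (hpos i)) hprod
  have hone : ((-1 : ℝ) ^ (i : ℕ)) * (-1) ^ (i : ℕ) = 1 := by rw [← mul_pow]; simp
  rw [Finset.prod_mul_distrib] at h1
  set Q := ∏ j ∈ Finset.univ.erase i, (lam i + lam j)
  set R := ∏ j ∈ Finset.univ.erase i, (lam i - lam j)
  set e := (-1 : ℝ) ^ (i : ℕ)
  set B := (altPoly n (fun k => signedCoeff p (k + 1))).eval (lam i)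
  have h2 : a * (e * lam i) * (e * (Q * R)) = B * R := by
    linear_combination (a * lam i * Q * R) * hone - R / 2 * h
  rwa [h2] at h1

lemma hurwitzTNN_signedCoeff {p : ℝ[X]} (hdeg : 1 ≤ p.natDegree) (hlead : 0 < p.leadingCoeff)
    (hsi : SelfInterlacingI p) : HurwitzTNN (signedCoeff p) := by
  obtain ⟨n, hn⟩ : ∃ n, p.natDegree = n + 1 := ⟨p.natDegree - 1, by omega⟩
  unfold SelfInterlacingI at hsi
  rw [hn] at hsi
  obtain ⟨lam, hp, hanti, hpos⟩ := hsi
  have hsign := eval_mul_prod_sub_pos hn hlead hp hanti hpos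
  have hinj : Function.Injective lam := by
    intro i j hij
    have hne := hsign i
    by_contra hij'
    rw [Finset.prod_eq_zero (i := j) (by simp [Ne.symm hij']) (by simp [hij])] at hne
    simp at hne
  set σ := Tuple.sort fun i => -lam i
  have hx : StrictAnti (lam ∘ σ) := by
    refine Antitone.strictAnti_of_injective (fun i j hij => ?_) (hinj.comp σ.injective)
    exact neg_le_neg_iff.mp (Tuple.monotone_sort (fun i => -lam i) hij)
  refine hurwitzTNN_of_interlacing (n + 1) _ ?_ p.leadingCoeff (-1) hlead (lam ∘ σ) hx ?_ ?_
  · intro k hk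
    rw [signedCoeff, if_neg (by omega)]
  · have h1 : ∏ i, (X - C ((lam ∘ σ) i)) = ∏ i, (X - C (lam i)) :=
      Equiv.prod_comp σ fun i => X - C (lam i)
    rw [h1, ← hp, Nat.add_sub_cancel]
    conv_lhs => rw [eq_altPoly_sub_altPoly hn]
    simp [sub_eq_add_neg]
  · intro i
    rw [Nat.add_sub_cancel]
    have h1 := hsign (σ i)
    have h2 : ∏ j ∈ Finset.univ.erase (σ i), (lam (σ i) - lam j) =
        ∏ j ∈ Finset.univ.erase i, (lam (σ i) - lam (σ j)) := by
      refine (Finset.prod_equiv σ (fun j => ?_) fun j _ => rfl).symm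
      simp
    have h3 : 0 < (-1) ^ (i : ℕ) *
        ∏ j ∈ Finset.univ.erase i, (lam (σ i) - lam (σ j)) := by
      rw [← prod_erase_ite_lt_neg_one, ← Finset.prod_mul_distrib]
      refine Finset.prod_pos fun j hj => ?_
      have hne := Finset.ne_of_mem_erase hj
      split_ifs with hlt
      · have := hx hlt
        simp only [Function.comp_apply] at this
        linarith
      · have := hx (lt_of_le_of_ne (not_lt.mp hlt) hne.symm)
        simp only [Function.comp_apply] at this
        linarith
    rw [h2] at h1
    have hone : ((-1 : ℝ) ^ (i : ℕ)) * (-1) ^ (i : ℕ) = 1 := by rw [← mul_pow]; simp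
    simp only [Function.comp_apply]
    set R := ∏ j ∈ Finset.univ.erase i, (lam (σ i) - lam (σ j))
    set e := (-1 : ℝ) ^ (i : ℕ)
    set B := (altPoly n (fun k => signedCoeff p (k + 1))).eval (lam (σ i))
    have h4 : 0 < (e * B) * R ^ 2 := by nlinarith [mul_pos h1 h3]
    exact pos_of_mul_pos_left h4 (sq_nonneg R)

lemma neg_one_pow_hurwitz_index {k r c : ℕ} (h : 2 * ((c : ℤ) + 1) - ((r : ℤ) + 1) = k) :
    (-1 : ℝ) ^ (k * (k + 1) / 2) = (-1) ^ ((r + 1) * r / 2 + (c + 1)) := by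
  obtain ⟨s, hs⟩ := Nat.even_mul_succ_self k
  obtain ⟨t, ht⟩ := Nat.even_mul_succ_self r
  have hs' : k * (k + 1) / 2 = s := by omega
  have ht' : (r + 1) * r / 2 = t := by rw [mul_comm]; omega
  rw [hs', ht']
  apply neg_one_pow_congr
  have key : (s : ℤ) = t + (c + 1) + 2 * ((c + 1) * (c - r)) := by
    zify at hs ht
    rw [← h] at hs
    linarith
  rw [← Int.even_coe_nat, ← Int.even_coe_nat, key]
  push_cast
  simp [Int.even_add]

lemma extendZero_signedCoeff (p : ℝ[X]) (r c : ℕ) :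
    extendZero (signedCoeff p) (2 * ((c : ℤ) + 1) - ((r : ℤ) + 1)) =
      (-1) ^ ((r + 1) * r / 2) *
        ((-1) ^ (c + 1) * aCoeff p (2 * ((c : ℤ) + 1) - ((r : ℤ) + 1))) := by
  rcases lt_or_ge (2 * ((c : ℤ) + 1) - ((r : ℤ) + 1)) 0 with h | h
  · rw [extendZero, aCoeff, if_neg (by omega), if_neg (by omega)]
    simp
  · obtain ⟨k, hk⟩ := Int.eq_ofNat_of_zero_le h
    rw [hk, extendZero, aCoeff, signedCoeff, if_pos (by omega), Int.toNat_natCast]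
    by_cases hle : k ≤ p.natDegree
    · rw [if_pos hle, if_pos (by omega), ← mul_assoc, ← pow_add]
      rw [neg_one_pow_hurwitz_index hk]
    · rw [if_neg hle, if_neg (by omega)]
      simp

/-- If `p` of degree `n ≥ 1` with positive leading coefficient is self-interlacing of
kind I, then for all strictly increasing row indices `i_1 < ⋯ < i_m` and column indices
`j_1 < ⋯ < j_m` (encoded by strictly monotone `r c : Fin m → Fin n`, `i_k = r k + 1`,
`j_k = c k + 1`) the signed minor
`(-1)^{Σ i_k(i_k-1)/2 + Σ j_k} · H_n(p)[i_1,…,i_m; j_1,…,j_m]` of the Hurwitz matrix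
(with entries `a_{2j-i}`) is nonnegative. -/
theorem selfInterlacing_signed_hurwitz_minors_nonneg
    (n : ℕ) (hn : 1 ≤ n) (p : Polynomial ℝ)
    (hdeg : p.natDegree = n) (hlead : 0 < p.leadingCoeff)
    (hsi : SelfInterlacingI p)
    (m : ℕ) (hm : 1 ≤ m)
    (r c : Fin m → Fin n) (hr : StrictMono r) (hc : StrictMono c) :
    0 ≤ (-1 : ℝ) ^ (∑ k : Fin m, (((r k : ℕ) + 1) * (r k : ℕ) / 2 + ((c k : ℕ) + 1))) *
      Matrix.det (Matrix.of fun k l : Fin m =>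
        aCoeff p (2 * ((c l : ℤ) + 1) - ((r k : ℤ) + 1))) := by
  have h := hurwitzTNN_signedCoeff (by omega) hlead hsi m (fun k => ((r k : ℕ) : ℤ) + 1)
    (fun k => ((c k : ℕ) : ℤ) + 1)
    (fun i j hij => by have := hr hij; simp only [Fin.lt_def] at this; simpa using this)
    (fun i j hij => by have := hc hij; simp only [Fin.lt_def] at this; simpa using this)
  simp only [extendZero_signedCoeff] at h
  convert h using 1
  rw [Finset.sum_add_distrib, pow_add, ← Finset.prod_pow_eq_pow_sum,
    ← Finset.prod_pow_eq_pow_sum, mul_assoc, ← Matrix.det_mul_row, ← Matrix.det_mul_column]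
  rfl
end
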